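/- arXiv:1608.04838 — 2 statements merged into one kernel-verified Lean document; each statement's English description precedes it below -/
import Mathlib

section
/- Let k ≥ 3 and n sufficiently large. If H is a k-partite k-graph with n vertices in each partition class and every legal (k-1)-set of vertices has degree at least n/k, then H has a matching of size at least n - 1. -/
namespace KPM
open Finset Function
open scoped Classical
set_option linter.unusedSectionVars false

variable {k : ℕ} {α : Type} [Fintype α]

/-- Pairwise disjoint tuples. -/
def Mat (M : Finset (Fin k → α)) : Prop := ∀ a ∈ M, ∀ b ∈ M, ∀ i, a i = b i → a = b

/-- number of elements with a property, as a real number -/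
noncomputable def cnt {β : Type} [Fintype β] (P : β → Prop) : ℝ :=
  ((@Finset.filter β P (fun _ => Classical.propDecidable _) univ).card : ℝ)

lemma cnt_eq {β : Type} [Fintype β] (P : β → Prop) [DecidablePred P] :
    cnt P = ((univ.filter P).card : ℝ) := by
  unfold cnt; congr

lemma cnt_filter {β : Type} [Fintype β] (s : Finset β) (P : β → Prop) [DecidablePred P] :
    ((s.filter P).card : ℝ) = cnt (fun x => x ∈ s ∧ P x) := by
  rw [cnt_eq]; congr 2; ext; simp

lemma cnt_mem {β : Type} [Fintype β] (s : Finset β) : cnt (fun x => x ∈ s) = (s.card : ℝ) := by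
  rw [cnt_eq]; congr 2; ext; simp

lemma cnt_nonneg {β : Type} [Fintype β] (P : β → Prop) : 0 ≤ cnt P := by unfold cnt; positivity

lemma cnt_mono {β : Type} [Fintype β] {P Q : β → Prop} (h : ∀ x, P x → Q x) : cnt P ≤ cnt Q := by
  unfold cnt
  exact_mod_cast card_le_card (fun x hx => by simp at hx ⊢; exact h x hx)

lemma cnt_congr {β : Type} [Fintype β] {P Q : β → Prop} (h : ∀ x, P x ↔ Q x) : cnt P = cnt Q := by
  congr; funext x; exact propext (h x)

lemma cnt_sum {β : Type} [Fintype β] (P : β → Prop) :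
    cnt P = ∑ x, if P x then (1 : ℝ) else 0 := by
  rw [cnt_eq]; simp

lemma cnt_split {β : Type} [Fintype β] (P Q : β → Prop) :
    cnt P = cnt (fun x => P x ∧ Q x) + cnt (fun x => P x ∧ ¬ Q x) := by
  simp only [cnt_sum, ← sum_add_distrib]
  refine sum_congr rfl fun x _ => ?_
  by_cases hP : P x <;> by_cases hQ : Q x <;> simp [hP, hQ]

lemma cnt_le_add {β : Type} [Fintype β] {P Q R : β → Prop} (h : ∀ x, P x → Q x ∨ R x) :
    cnt P ≤ cnt Q + cnt R := by
  rw [cnt_split P Q]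
  exact add_le_add (cnt_mono fun x hx => hx.2) (cnt_mono fun x hx => (h x hx.1).resolve_left hx.2)

lemma cnt_exists {β : Type} [Fintype β] {P : β → Prop} (h : 0 < cnt P) : ∃ x, P x := by
  unfold cnt at h
  have : 0 < (@Finset.filter β P (fun _ => Classical.propDecidable _) univ).card := by
    exact_mod_cast h
  obtain ⟨x, hx⟩ := card_pos.mp this
  exact ⟨x, by simpa using hx⟩

lemma cnt_fiber {β γ : Type} [Fintype β] [Fintype γ] (P : β → Prop) (φ : β → γ) :
    cnt P = ∑ c, cnt (fun x => φ x = c ∧ P x) := by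
  simp only [cnt_sum]
  rw [sum_comm]
  refine sum_congr rfl fun x _ => ?_
  rw [sum_eq_single (φ x)] <;> simp +contextual [eq_comm]

/-- Codegree condition. -/
def Deg (E : Finset (Fin k → α)) : Prop :=
  ∀ (f : Fin k → α) (i : Fin k), (Fintype.card α : ℝ) / k ≤ cnt (fun v => update f i v ∈ E)

/-- vertices of class `i` covered by `M` -/
noncomputable def cov (M : Finset (Fin k → α)) (i : Fin k) : Finset α := M.image (fun e => e i)

lemma mem_cov {M : Finset (Fin k → α)} {i : Fin k} {v : α} :
    v ∈ cov M i ↔ ∃ e ∈ M, e i = v := by simp [cov]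

lemma cov_card {M : Finset (Fin k → α)} (hM : Mat M) (i : Fin k) : (cov M i).card = M.card := by
  apply card_image_of_injOn
  intro a ha b hb h
  exact hM a ha b hb i h

lemma cov_card_le (M : Finset (Fin k → α)) (i : Fin k) : (cov M i).card ≤ M.card := card_image_le

lemma mat_card_le {M : Finset (Fin k → α)} (hM : Mat M) (i : Fin k) :
    M.card ≤ Fintype.card α := by
  rw [← cov_card hM i]; exact card_le_univ _

/-- double counting along one coordinate -/
lemma fiber (P : (Fin k → α) → Prop) (i : Fin k) :
    (Fintype.card α : ℝ) * cnt P = ∑ f : Fin k → α, cnt (fun v => P (update f i v)) := by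
  let φ : ((Fin k → α) × α) ≃ ((Fin k → α) × α) :=
    { toFun := fun p => (update p.1 i p.2, p.1 i)
      invFun := fun p => (update p.1 i p.2, p.1 i)
      left_inv := fun p => by simp
      right_inv := fun p => by simp }
  have h1 : ∑ f : Fin k → α, cnt (fun v => P (update f i v))
      = ∑ p : (Fin k → α) × α, if P (φ p).1 then (1 : ℝ) else 0 := by
    rw [Fintype.sum_prod_type]
    refine sum_congr rfl (fun f _ => ?_)
    rw [cnt_sum]
    rfl
  rw [h1, Equiv.sum_comp φ (fun p => if P p.1 then (1 : ℝ) else 0), Fintype.sum_prod_type_right]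
  simp [cnt_eq]

lemma count_all : cnt (fun _ : Fin k → α => True) = (Fintype.card α : ℝ) ^ k := by
  simp [cnt_eq]

lemma cnt_le_all (P : (Fin k → α) → Prop) : cnt P ≤ (Fintype.card α : ℝ) ^ k := by
  rw [← count_all]; exact cnt_mono (fun _ _ => trivial)

lemma count_pi (s : Fin k → Finset α) :
    (univ.filter (fun f : Fin k → α => ∀ j, f j ∈ s j)).card = ∏ j, (s j).card := by
  rw [← Fintype.card_piFinset]
  congr 1
  ext f; simp

lemma count_one (j : Fin k) (W : Finset α) :
    (univ.filter (fun f : Fin k → α => f j ∈ W)).card = W.card * Fintype.card α ^ (k - 1) := by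
  have := count_pi (fun l : Fin k => if l = j then W else univ)
  rw [show (univ.filter (fun f : Fin k → α => f j ∈ W)) =
    (univ.filter (fun f : Fin k → α => ∀ l, f l ∈ if l = j then W else univ)) from ?_, this]
  · rw [← mul_prod_erase univ _ (mem_univ j)]
    simp only [if_true]
    congr 1
    rw [prod_congr rfl (g := fun _ => Fintype.card α)]
    · simp
    · intro x hx
      simp [(mem_erase.mp hx).1]
  · ext f
    simp only [mem_filter, mem_univ, true_and]
    constructor
    · intro h l
      split_ifs with hl
      · exact hl ▸ h
      · simp
    · intro h
      simpa using h j

lemma count_two {i j : Fin k} (hij : j ≠ i) (v : α) (W : Finset α) :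
    (univ.filter (fun f : Fin k → α => f i = v ∧ f j ∈ W)).card
      = W.card * Fintype.card α ^ (k - 2) := by
  have := count_pi (fun l : Fin k => if l = i then {v} else if l = j then W else univ)
  rw [show (univ.filter (fun f : Fin k → α => f i = v ∧ f j ∈ W)) =
    (univ.filter (fun f : Fin k → α =>
      ∀ l, f l ∈ if l = i then {v} else if l = j then W else univ)) from ?_, this]
  · rw [← mul_prod_erase univ _ (mem_univ i),
      ← mul_prod_erase (univ.erase i) _ (mem_erase.mpr ⟨hij, mem_univ j⟩)]
    simp only [if_true, hij, if_false, card_singleton, one_mul]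
    congr 1
    rw [prod_congr rfl (g := fun _ => Fintype.card α)]
    · simp [card_erase_of_mem, hij]
      rfl
    · intro x hx
      simp only [mem_erase] at hx
      simp [hx.1, hx.2.1]
  · ext f
    simp only [mem_filter, mem_univ, true_and]
    constructor
    · rintro ⟨h1, h2⟩ l
      split_ifs with hl hl'
      · subst hl; simp [h1]
      · exact hl' ▸ h2
      · simp
    · intro h
      have h1 := h i
      have h2 := h j
      simp [hij] at h1 h2
      exact ⟨h1, h2⟩

lemma count_touch (W : Fin k → Finset α) (w : ℝ) (hw : ∀ j, ((W j).card : ℝ) ≤ w) :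
    cnt (fun f : Fin k → α => ∃ j, f j ∈ W j)
      ≤ k * w * (Fintype.card α : ℝ) ^ (k - 1) := by
  rw [cnt_eq]
  have h1 : (univ.filter (fun f : Fin k → α => ∃ j, f j ∈ W j)) ⊆
      univ.biUnion (fun j => univ.filter (fun f : Fin k → α => f j ∈ W j)) := by
    intro f; simp
  have h2 := (card_le_card h1).trans card_biUnion_le
  simp only [count_one] at h2
  calc _ ≤ ((∑ j, (W j).card * Fintype.card α ^ (k - 1) : ℕ) : ℝ) := by exact_mod_cast h2
    _ ≤ ∑ j : Fin k, w * (Fintype.card α : ℝ) ^ (k - 1) := by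
        push_cast
        apply sum_le_sum
        intro j _
        have := hw j
        gcongr
    _ = _ := by simp; ring

lemma count_touch_at (i : Fin k) (v : α) (W : Fin k → Finset α) (w : ℝ)
    (hw : ∀ j, ((W j).card : ℝ) ≤ w) :
    cnt (fun f : Fin k → α => f i = v ∧ ∃ j, j ≠ i ∧ f j ∈ W j)
      ≤ k * w * (Fintype.card α : ℝ) ^ (k - 2) := by
  rw [cnt_eq]
  have h0 : 0 ≤ w := le_trans (by positivity) (hw i)
  have h1 : (univ.filter (fun f : Fin k → α => f i = v ∧ ∃ j, j ≠ i ∧ f j ∈ W j)) ⊆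
      (univ.erase i).biUnion (fun j => univ.filter (fun f : Fin k → α => f i = v ∧ f j ∈ W j)) := by
    intro f; simp; tauto
  have h2 := (card_le_card h1).trans card_biUnion_le
  rw [sum_congr rfl (fun j hj => count_two (mem_erase.mp hj).1 v (W j))] at h2
  calc _ ≤ ((∑ j ∈ univ.erase i, (W j).card * Fintype.card α ^ (k - 2) : ℕ) : ℝ) := by
        exact_mod_cast h2
    _ ≤ ∑ j ∈ univ.erase i, w * (Fintype.card α : ℝ) ^ (k - 2) := by
        push_cast
        apply sum_le_sum
        intro j _
        have := hw j
        gcongr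
    _ ≤ ∑ j : Fin k, w * (Fintype.card α : ℝ) ^ (k - 2) := by
        apply sum_le_sum_of_subset_of_nonneg (erase_subset _ _)
        intros; positivity
    _ = _ := by simp; ring

lemma count_at (i : Fin k) (v : α) :
    cnt (fun f : Fin k → α => f i = v) = (Fintype.card α : ℝ) ^ (k - 1) := by
  rw [cnt_eq]
  have := count_one i ({v} : Finset α)
  simp only [mem_singleton, card_singleton, one_mul] at this
  rw [this]; push_cast; rfl

/-- exchange lemma -/
lemma swap (hk : 0 < k) {M F G : Finset (Fin k → α)} (hM : Mat M) (hF : F ⊆ M) (hG : Mat G)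
    (h : ∀ g ∈ G, ∀ e ∈ M, ∀ i, g i = e i → e ∈ F) :
    Mat ((M \ F) ∪ G) ∧ ((M \ F) ∪ G).card + F.card = M.card + G.card := by
  constructor
  · intro a ha b hb i hab
    simp only [mem_union, mem_sdiff] at ha hb
    rcases ha with ha | ha <;> rcases hb with hb | hb
    · exact hM a ha.1 b hb.1 i hab
    · exact absurd (h b hb a ha.1 i hab.symm) ha.2
    · exact absurd (h a ha b hb.1 i hab) hb.2
    · exact hG a ha b hb i hab
  · rw [card_union_of_disjoint, card_sdiff_of_subset hF]
    · have := card_le_card hF; omega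
    · rw [disjoint_left]
      intro a ha hG'
      rw [mem_sdiff] at ha
      exact ha.2 (h a hG' a ha.1 ⟨0, hk⟩ rfl)

lemma mat_pair {a b : Fin k → α} (h : ∀ i, a i ≠ b i) : Mat ({a, b} : Finset (Fin k → α)) := by
  intro x hx y hy i hxy
  simp only [mem_insert, mem_singleton] at hx hy
  rcases hx with rfl | rfl <;> rcases hy with rfl | rfl
  · rfl
  · exact absurd hxy (h i)
  · exact absurd hxy.symm (h i)
  · rfl

lemma mat_insert {M : Finset (Fin k → α)} (hk : 0 < k) (hM : Mat M) {e : Fin k → α}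
    (h : ∀ f ∈ M, ∀ i, e i ≠ f i) :
    Mat (insert e M) ∧ e ∉ M ∧ (insert e M).card = M.card + 1 := by
  have hn : e ∉ M := fun he => h e he ⟨0, hk⟩ rfl
  refine ⟨?_, hn, card_insert_of_notMem hn⟩
  intro x hx y hy i hxy
  simp only [mem_insert] at hx hy
  rcases hx with rfl | hx <;> rcases hy with rfl | hy
  · rfl
  · exact absurd hxy (h y hy i)
  · exact absurd hxy.symm (h x hx i)
  · exact hM x hx y hy i hxy

/-- replace one edge by two -/
lemma two_hit (hk : 0 < k) {M E : Finset (Fin k → α)} (hM : Mat M) (hME : M ⊆ E) {e a b : Fin k → α}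
    (he : e ∈ M) (ha : a ∈ E) (hb : b ∈ E) (hab : ∀ i, a i ≠ b i)
    (hae : ∀ f ∈ M, ∀ i, a i = f i → f = e) (hbe : ∀ f ∈ M, ∀ i, b i = f i → f = e) :
    ∃ M', Mat M' ∧ M' ⊆ E ∧ M'.card = M.card + 1 ∧ M.erase e ⊆ M' ∧
      M' ⊆ insert a (insert b M) := by
  have hne : a ≠ b := fun h => hab ⟨0, hk⟩ (by rw [h])
  have := swap hk (F := {e}) hM (by simpa using he) (mat_pair hab) (by
    intro g hg f hf i hgi
    simp only [mem_insert, mem_singleton] at hg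
    rcases hg with rfl | rfl
    · simpa using hae f hf i hgi
    · simpa using hbe f hf i hgi)
  refine ⟨_, this.1, ?_, ?_, ?_, ?_⟩
  · intro x hx
    simp only [mem_union, mem_sdiff, mem_insert, mem_singleton] at hx
    rcases hx with hx | rfl | rfl
    · exact hME hx.1
    · exact ha
    · exact hb
  · have := this.2
    rw [card_pair hne, card_singleton] at this
    omega
  · intro x hx
    simp only [mem_union, mem_sdiff, mem_singleton]
    rw [mem_erase] at hx
    exact Or.inl ⟨hx.2, hx.1⟩
  · intro x hx
    simp only [mem_union, mem_sdiff, mem_insert, mem_singleton] at hx ⊢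
    tauto


lemma fiber_deg (hk : 0 < k) (hn : 0 < Fintype.card α) (P Q : (Fin k → α) → Prop) (i : Fin k)
    (hP : ∀ f v, P (update f i v) ↔ P f)
    (hQ : ∀ f, (Fintype.card α : ℝ) / k ≤ cnt (fun v => Q (update f i v))) :
    cnt P ≤ k * cnt (fun f => P f ∧ Q f) := by
  have h2 := fiber (fun f => P f ∧ Q f) i
  have h3 : ∑ f : Fin k → α, (if P f then (1 : ℝ) else 0) * ((Fintype.card α : ℝ) / k) ≤
      ∑ f : Fin k → α, cnt (fun v => P (update f i v) ∧ Q (update f i v)) := by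
    apply sum_le_sum
    intro f _
    by_cases hf : P f
    · simp only [hf, if_true, hP, true_and, one_mul]
      exact hQ f
    · simp [hf, cnt_nonneg]
  rw [← h2, ← sum_mul, ← cnt_sum] at h3
  have hk' : (0 : ℝ) < k := by exact_mod_cast hk
  have hn' : (0 : ℝ) < Fintype.card α := by exact_mod_cast hn
  have h4 : (Fintype.card α : ℝ) * cnt P ≤
      (Fintype.card α : ℝ) * (k * cnt (fun f => P f ∧ Q f)) := by
    calc _ = k * (cnt P * ((Fintype.card α : ℝ) / k)) := by field_simp
      _ ≤ k * (Fintype.card α * cnt (fun f => P f ∧ Q f)) := by gcongr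
      _ = _ := by ring
  exact le_of_mul_le_mul_left h4 hn'

def Ab (E : Finset (Fin k → α)) (i0 i1 : Fin k) (u w e : Fin k → α) : Prop :=
  update u i0 (e i0) ∈ E ∧ update (update e i0 (w i0)) i1 (w i1) ∈ E

lemma absorbers {E : Finset (Fin k → α)} (hE : Deg E) (hk : 0 < k) (hn : 0 < Fintype.card α)
    {i0 i1 i2 : Fin k} (h01 : i0 ≠ i1) (h02 : i0 ≠ i2) (h12 : i1 ≠ i2) (u w : Fin k → α) :
    (Fintype.card α : ℝ) ^ k ≤ k ^ 3 * ((E.filter (Ab E i0 i1 u w)).card : ℝ) := by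
  have a1 := fiber_deg hk hn (fun _ => True) (fun f => update u i0 (f i0) ∈ E) i0
    (by simp) (by intro f; simpa using hE u i0)
  have a2 := fiber_deg hk hn (fun f => True ∧ update u i0 (f i0) ∈ E)
    (fun f => update (update f i0 (w i0)) i1 (w i1) ∈ E) i2
    (by intro f v; simp [h02]) (by
      intro f
      have := hE (update (update f i0 (w i0)) i1 (w i1)) i2
      convert this using 4 with v
      rw [update_comm h02.symm, update_comm h12.symm])
  have a3 := fiber_deg hk hn (fun f => (True ∧ update u i0 (f i0) ∈ E) ∧
      update (update f i0 (w i0)) i1 (w i1) ∈ E) (fun f => f ∈ E) i1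
    (by
      intro f v
      rw [update_comm h01.symm, update_idem]
      simp [h01]) (fun f => hE f i1)
  have hs : cnt (fun f => ((True ∧ update u i0 (f i0) ∈ E) ∧
      update (update f i0 (w i0)) i1 (w i1) ∈ E) ∧ f ∈ E) =
      ((E.filter (Ab E i0 i1 u w)).card : ℝ) := by
    rw [cnt_filter]
    apply cnt_congr
    intro f
    simp [Ab]
    tauto
  rw [hs] at a3
  rw [count_all] at a1
  have hk' : (0 : ℝ) < k := by exact_mod_cast hk
  calc _ ≤ _ := a1
    _ ≤ k * (k * _) := by gcongr
    _ ≤ k * (k * (k * _)) := by gcongr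
    _ = _ := by ring

noncomputable def Phi (E : Finset (Fin k → α)) (i0 i1 : Fin k) (M : Finset (Fin k → α)) : ℝ :=
  ∑ p : (Fin k → α) × (Fin k → α), (1 / 2 : ℝ) ^ ((M.filter (Ab E i0 i1 p.1 p.2)).card)

lemma touch_mat (M : Finset (Fin k → α)) :
    cnt (fun f : Fin k → α => ∃ j, f j ∈ cov M j)
      ≤ k * M.card * (Fintype.card α : ℝ) ^ (k - 1) :=
  count_touch (fun j => cov M j) _ (fun j => by exact_mod_cast cov_card_le M j)

lemma greedy_step {E : Finset (Fin k → α)} (hE : Deg E) (hk : 0 < k) (hn : 0 < Fintype.card α)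
    {i0 i1 i2 : Fin k} (h01 : i0 ≠ i1) (h02 : i0 ≠ i2) (h12 : i1 ≠ i2)
    (M : Finset (Fin k → α)) (hM : Mat M) (hsmall : 2 * k ^ 4 * M.card ≤ Fintype.card α) :
    ∃ e ∈ E, (∀ f ∈ M, ∀ i, e i ≠ f i) ∧
      Phi E i0 i1 (insert e M) ≤ (1 - 1 / (4 * k ^ 3)) * Phi E i0 i1 M := by
  have hk' : (0 : ℝ) < k := by exact_mod_cast hk
  have hn' : (0 : ℝ) < Fintype.card α := by exact_mod_cast hn
  set n : ℝ := (Fintype.card α : ℝ) with hndef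
  set Fr := E.filter (fun e => ¬ ∃ j, e j ∈ cov M j) with hFr
  have hdisj : ∀ e ∈ Fr, ∀ f ∈ M, ∀ i, e i ≠ f i := by
    intro e he f hf i hei
    rw [hFr, mem_filter] at he
    exact he.2 ⟨i, mem_cov.mpr ⟨f, hf, hei.symm⟩⟩
  have hpow : n ^ (k - 1) * n = n ^ k := by
    rw [← pow_succ]; congr 1; omega
  have hFrcard : (Fr.card : ℝ) ≤ n ^ k := by
    rw [← cnt_mem]; exact cnt_le_all _
  have habs : ∀ u w, (Fr.card : ℝ) / (2 * k ^ 3) ≤ ((Fr.filter (Ab E i0 i1 u w)).card : ℝ) := by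
    intro u w
    have b1 := absorbers hE hk hn h01 h02 h12 u w
    have b2 : (E.filter (Ab E i0 i1 u w)) ⊆ (Fr.filter (Ab E i0 i1 u w)) ∪
        (univ.filter (fun f : Fin k → α => ∃ j, f j ∈ cov M j)) := by
      intro f hf
      rw [mem_filter] at hf
      by_cases h : ∃ j, f j ∈ cov M j
      · simp [h]
      · simp only [mem_union, mem_filter, hFr]
        exact Or.inl ⟨⟨hf.1, h⟩, hf.2⟩
    have b3 := (card_le_card b2).trans (card_union_le _ _)
    have b3' : ((E.filter (Ab E i0 i1 u w)).card : ℝ) ≤ (Fr.filter (Ab E i0 i1 u w)).card +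
      (univ.filter (fun f : Fin k → α => ∃ j, f j ∈ cov M j)).card := by exact_mod_cast b3
    have b4 := touch_mat M
    rw [cnt_eq] at b4
    have hs : (2 : ℝ) * k ^ 4 * M.card ≤ n := by rw [hndef]; exact_mod_cast hsmall
    rw [div_le_iff₀ (by positivity)]
    have b5 : 2 * (k : ℝ) ^ 3 * (k * M.card * n ^ (k - 1)) ≤ n ^ k := by
      calc _ = (2 * k ^ 4 * M.card) * n ^ (k - 1) := by ring
        _ ≤ n * n ^ (k - 1) := by gcongr
        _ = n ^ k := by rw [mul_comm, hpow]
    have b6 : (k : ℝ) ^ 3 * ((E.filter (Ab E i0 i1 u w)).card : ℝ) ≤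
        k ^ 3 * ((Fr.filter (Ab E i0 i1 u w)).card + k * M.card * n ^ (k - 1)) := by
      gcongr
      linarith
    nlinarith
  have hFrpos : 0 < Fr.card := by
    obtain ⟨a⟩ : Nonempty α := Fintype.card_pos_iff.mp hn
    by_contra hcon
    have h0 : Fr = ∅ := by rw [← card_eq_zero]; omega
    have b1 := absorbers hE hk hn h01 h02 h12 (fun _ => a) (fun _ => a)
    have b2 : (E.filter (Ab E i0 i1 (fun _ => a) (fun _ => a))) ⊆
        (univ.filter (fun f : Fin k → α => ∃ j, f j ∈ cov M j)) := by
      intro f hf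
      by_contra h
      have : f ∈ Fr := by
        simp only [mem_filter, mem_univ, true_and] at h
        rw [hFr, mem_filter]; exact ⟨(mem_filter.mp hf).1, h⟩
      simp [h0] at this
    have b3 : ((E.filter (Ab E i0 i1 (fun _ => a) (fun _ => a))).card : ℝ) ≤
      (univ.filter (fun f : Fin k → α => ∃ j, f j ∈ cov M j)).card := by
        exact_mod_cast card_le_card b2
    have b4 := touch_mat M
    rw [cnt_eq] at b4
    have hs : (2 : ℝ) * k ^ 4 * M.card ≤ n := by rw [hndef]; exact_mod_cast hsmall
    have b5 : 2 * (k : ℝ) ^ 3 * (k * M.card * n ^ (k - 1)) ≤ n ^ k := by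
      calc _ = (2 * k ^ 4 * M.card) * n ^ (k - 1) := by ring
        _ ≤ n * n ^ (k - 1) := by gcongr
        _ = n ^ k := by rw [mul_comm, hpow]
    have b6 : (k : ℝ) ^ 3 * ((E.filter (Ab E i0 i1 (fun _ => a) (fun _ => a))).card : ℝ) ≤
        k ^ 3 * (k * M.card * n ^ (k - 1)) := by
      gcongr
      linarith
    have : 0 < n ^ k := by positivity
    nlinarith
  have hsum : ∑ e ∈ Fr, Phi E i0 i1 (insert e M) ≤
      ∑ e ∈ Fr, (1 - 1 / (4 * k ^ 3)) * Phi E i0 i1 M := by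
    unfold Phi
    rw [sum_comm, sum_const, nsmul_eq_mul, mul_sum, mul_sum]
    apply sum_le_sum
    rintro ⟨u, w⟩ _
    simp only
    have c1 : ∀ e ∈ Fr, (1 / 2 : ℝ) ^ (((insert e M).filter (Ab E i0 i1 u w)).card) =
        (1 / 2 : ℝ) ^ ((M.filter (Ab E i0 i1 u w)).card) *
          (1 - (if Ab E i0 i1 u w e then 1 / 2 else 0)) := by
      intro e he
      have hne : e ∉ M := fun h => hdisj e he e h i0 rfl
      rw [filter_insert]
      split_ifs with h
      · rw [card_insert_of_notMem (by simp [hne]), pow_succ]; norm_num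
      · simp
    rw [sum_congr rfl c1, ← mul_sum, sum_sub_distrib, ← sum_filter]
    simp only [sum_const, nsmul_eq_mul, mul_one]
    have c2 := habs u w
    have c3 : (Fr.card : ℝ) - (Fr.filter (Ab E i0 i1 u w)).card * (1 / 2) ≤
        Fr.card * (1 - 1 / (4 * k ^ 3)) := by
      have : (Fr.card : ℝ) / (2 * k ^ 3) = 2 * (Fr.card * (1 / (4 * k ^ 3))) := by
        field_simp; norm_num
      rw [this] at c2
      linarith
    calc _ ≤ (1 / 2 : ℝ) ^ ((M.filter (Ab E i0 i1 u w)).card) * (Fr.card * (1 - 1 / (4 * k ^ 3))) := by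
          gcongr
      _ = _ := by ring
  obtain ⟨e, he, hle⟩ := exists_le_of_sum_le (card_pos.mp hFrpos) hsum
  exact ⟨e, (mem_filter.mp he).1, hdisj e he, hle⟩

lemma greedy {E : Finset (Fin k → α)} (hE : Deg E) (hk : 0 < k) (hn : 0 < Fintype.card α)
    {i0 i1 i2 : Fin k} (h01 : i0 ≠ i1) (h02 : i0 ≠ i2) (h12 : i1 ≠ i2) (T : ℕ)
    (hsmall : 2 * k ^ 4 * T ≤ Fintype.card α) :
    ∃ M ⊆ E, Mat M ∧ M.card = T ∧
      Phi E i0 i1 M ≤ (1 - 1 / (4 * k ^ 3)) ^ T * (Fintype.card α : ℝ) ^ (2 * k) := by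
  induction T with
  | zero =>
    refine ⟨∅, by simp, by intro a ha; simp at ha, rfl, ?_⟩
    simp [Phi]
    rw [← pow_add]
    apply le_of_eq; congr 1; ring
  | succ T ih =>
    obtain ⟨M, hME, hM, hc, hphi⟩ := ih (le_trans (by gcongr; omega) hsmall)
    obtain ⟨e, he, hd, hle⟩ := greedy_step hE hk hn h01 h02 h12 M hM
      (by rw [hc]; exact le_trans (by gcongr; omega) hsmall)
    have := mat_insert hk hM hd
    refine ⟨insert e M, insert_subset he hME, this.1, by rw [this.2.2, hc], hle.trans ?_⟩
    have hk' : (1 : ℝ) ≤ k := by exact_mod_cast hk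
    have hρ : (0 : ℝ) ≤ 1 - 1 / (4 * k ^ 3) := by
      rw [sub_nonneg, div_le_one (by positivity)]
      have : (1 : ℝ) ≤ k ^ 3 := one_le_pow₀ hk'
      linarith
    rw [pow_succ' _ T, mul_assoc]
    gcongr

/-- absorbing matching -/
lemma absorbing (hk : 3 ≤ k) (D C : ℕ) (hD : 2 * k ^ 4 ≤ D) :
    ∃ n0 : ℕ, ∀ (α : Type) [Fintype α], n0 ≤ Fintype.card α → ∀ E : Finset (Fin k → α), Deg E →
      ∃ i0 i1 : Fin k, i0 ≠ i1 ∧ ∃ M ⊆ E, Mat M ∧ D * M.card ≤ Fintype.card α ∧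
        ∀ u w, C ≤ (M.filter (Ab E i0 i1 u w)).card := by
  have hk1 : (1 : ℝ) ≤ k := by exact_mod_cast (by omega : 1 ≤ k)
  have hDpos : 0 < D := lt_of_lt_of_le (by positivity) hD
  set ρ : ℝ := 1 - 1 / (4 * k ^ 3) with hρ
  have hρ0 : 0 ≤ ρ := by
    rw [hρ, sub_nonneg, div_le_one (by positivity)]
    have : (1 : ℝ) ≤ k ^ 3 := one_le_pow₀ hk1
    linarith
  have hρ1 : ρ < 1 := by
    rw [hρ]
    have : (0 : ℝ) < 1 / (4 * k ^ 3) := by positivity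
    linarith
  have ht := tendsto_pow_const_mul_const_pow_of_abs_lt_one (2 * k) (r := ρ)
    (by rw [abs_of_nonneg hρ0]; exact hρ1)
  have ht' : ∀ᶠ T : ℕ in Filter.atTop, ((T : ℝ)) ^ (2 * k) * ρ ^ T < (1 / 2) ^ C / (2 * D) ^ (2 * k) := by
    exact ht.eventually_lt_const (by positivity)
  obtain ⟨T0, hT0⟩ := Filter.eventually_atTop.mp ht'
  refine ⟨D * (T0 + 1), ?_⟩
  intro α _ hn E hE
  set n := Fintype.card α with hndef
  set T := n / D with hT
  have hTT : T0 + 1 ≤ T := by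
    rw [hT, Nat.le_div_iff_mul_le hDpos, mul_comm]; exact hn
  have hDT : D * T ≤ n := Nat.mul_div_le n D
  have hnT : n ≤ 2 * D * T := by
    have : n < D * (T + 1) := by
      rw [hT]; exact Nat.lt_mul_div_succ n hDpos
    nlinarith
  have hnpos : 0 < n := lt_of_lt_of_le (by positivity) hn
  let i0 : Fin k := ⟨0, by omega⟩
  let i1 : Fin k := ⟨1, by omega⟩
  let i2 : Fin k := ⟨2, by omega⟩
  have h01 : i0 ≠ i1 := by simp [i0, i1]
  have h02 : i0 ≠ i2 := by simp [i0, i2]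
  have h12 : i1 ≠ i2 := by simp [i1, i2]
  obtain ⟨M, hME, hM, hc, hphi⟩ := greedy hE (by omega) hnpos h01 h02 h12 T
    (le_trans (by gcongr) hDT)
  refine ⟨i0, i1, h01, M, hME, hM, by rw [hc]; exact hDT, ?_⟩
  intro u w
  have h1 : (1 / 2 : ℝ) ^ ((M.filter (Ab E i0 i1 u w)).card) ≤ Phi E i0 i1 M := by
    unfold Phi
    exact single_le_sum (f := fun p : (Fin k → α) × (Fin k → α) =>
      (1 / 2 : ℝ) ^ ((M.filter (Ab E i0 i1 p.1 p.2)).card)) (fun _ _ => by positivity)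
      (mem_univ (u, w))
  have h2 : ρ ^ T * (n : ℝ) ^ (2 * k) ≤ (1 / 2 : ℝ) ^ C := by
    have := hT0 T (by omega)
    have hn2 : (n : ℝ) ≤ 2 * D * T := by exact_mod_cast hnT
    calc _ ≤ ρ ^ T * (2 * D * T) ^ (2 * k) := by gcongr
      _ = (2 * D : ℝ) ^ (2 * k) * ((T : ℝ) ^ (2 * k) * ρ ^ T) := by rw [mul_pow (2 * D : ℝ)]; ring
      _ ≤ (2 * D : ℝ) ^ (2 * k) * ((1 / 2) ^ C / (2 * D) ^ (2 * k)) := by gcongr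
      _ = _ := by field_simp
  have h3 := h1.trans (hphi.trans h2)
  exact (pow_le_pow_iff_right_of_lt_one₀ (by norm_num) (by norm_num)).mp h3

/-- using the absorbing matching -/
lemma absorb_all (hk : 0 < k) {E : Finset (Fin k → α)} {i0 i1 : Fin k} (h01 : i0 ≠ i1) (C : ℕ) :
    ∀ M ⊆ E, Mat M → ∀ M0 ⊆ M, (∀ u w, C ≤ (M0.filter (Ab E i0 i1 u w)).card) →
      Fintype.card α ≤ M.card + C + 1 →
      ∃ M' ⊆ E, Mat M' ∧ Fintype.card α ≤ M'.card + 1 := by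
  induction C with
  | zero => intro M hME hM M0 _ _ h; exact ⟨M, hME, hM, h⟩
  | succ C ih =>
    intro M hME hM M0 hM0 hab hc
    by_cases hdone : Fintype.card α ≤ M.card + 1
    · exact ⟨M, hME, hM, hdone⟩
    have hex : ∀ j : Fin k, ∃ a b : α, a ∉ cov M j ∧ b ∉ cov M j ∧ a ≠ b := by
      intro j
      have h1 : 1 < ((cov M j)ᶜ).card := by
        rw [card_compl, cov_card hM]; omega
      obtain ⟨a, ha, b, hb, hne⟩ := one_lt_card.mp h1
      exact ⟨a, b, by simpa using ha, by simpa using hb, hne⟩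
    choose u w hu hw huw using hex
    have hu' : ∀ f ∈ M, ∀ j, u j ≠ f j := fun f hf j h => hu j (mem_cov.mpr ⟨f, hf, h.symm⟩)
    have hw' : ∀ f ∈ M, ∀ j, w j ≠ f j := fun f hf j h => hw j (mem_cov.mpr ⟨f, hf, h.symm⟩)
    have hpos : 0 < (M0.filter (Ab E i0 i1 u w)).card := lt_of_lt_of_le (Nat.succ_pos C) (hab u w)
    obtain ⟨e, he⟩ := card_pos.mp hpos
    rw [mem_filter] at he
    obtain ⟨he0, hA, hB⟩ := he
    have heM := hM0 he0
    obtain ⟨M', hM', hM'E, hcard, hsub, -⟩ := two_hit hk hM hME heM hA hB (by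
        intro i
        by_cases h0 : i = i0
        · subst h0
          simp [update_of_ne h01, (hw' e heM _).symm]
        · by_cases h1 : i = i1
          · subst h1
            simp [update_of_ne h0, huw]
          · simp [update_of_ne h0, update_of_ne h1, hu' e heM]) (by
        intro f hf i hi
        by_cases h0 : i = i0
        · subst h0
          simp at hi
          exact (hM e heM f hf _ hi).symm
        · rw [update_of_ne h0] at hi
          exact absurd hi (hu' f hf i)) (by
        intro f hf i hi
        by_cases h1 : i = i1
        · subst h1
          simp at hi
          exact absurd hi (hw' f hf _)
        · rw [update_of_ne h1] at hi
          by_cases h0 : i = i0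
          · subst h0
            simp at hi
            exact absurd hi (hw' f hf _)
          · rw [update_of_ne h0] at hi
            exact (hM e heM f hf _ hi).symm)
    refine ih M' hM'E hM' (M0.erase e) ((erase_subset_erase e hM0).trans hsub) ?_ (by omega)
    intro u' w'
    have := hab u' w'
    rw [filter_erase]
    have := pred_card_le_card_erase (s := M0.filter (Ab E i0 i1 u' w')) (a := e)
    omega


lemma near_or_ext (hk : 0 < k) {E : Finset (Fin k → α)} (hE : Deg E)
    {M0 : Finset (Fin k → α)} (hM0 : Mat M0) (hM0E : M0 ⊆ E) {δ : ℝ} (hδ : 0 ≤ δ)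
    (hM0c : (M0.card : ℝ) ≤ δ * Fintype.card α) :
    (∃ M ⊆ E, Mat M ∧ M0 ⊆ M ∧ Fintype.card α ≤ M.card + k * k) ∨
    ∃ A : Fin k → Finset α,
      (∀ i, |((A i).card : ℝ) - Fintype.card α / k| ≤ k * (1 + k * (k + 1)) * δ * Fintype.card α) ∧
      cnt (fun f => f ∈ E ∧ ∀ j, f j ∉ A j) ≤
        k * (k * (1 + k * (k + 1)) * δ * Fintype.card α) * (Fintype.card α : ℝ) ^ (k - 1) := by
  obtain ⟨M, hMmem, hMmax⟩ := exists_max_image (E.powerset.filter (fun M => Mat M ∧ M0 ⊆ M))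
    (fun M => M.card) ⟨M0, by simp [hM0, hM0E]⟩
  simp only [mem_filter, mem_powerset] at hMmem hMmax
  obtain ⟨hME, hM, hM0M⟩ := hMmem
  have hmax : ∀ M', Mat M' → M' ⊆ E → M0 ⊆ M' → M'.card ≤ M.card :=
    fun M' h1 h2 h3 => hMmax M' ⟨h2, h1, h3⟩
  by_cases hdone : Fintype.card α ≤ M.card + k * k
  · exact Or.inl ⟨M, hME, hM, hM0M, hdone⟩
  right
  have hemb : ∀ j : Fin k, ∃ u : Fin k × Fin k → α, Injective u ∧ ∀ p, u p ∉ cov M j := by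
    intro j
    have h1 : Fintype.card (Fin k × Fin k) ≤ Fintype.card {v // v ∈ (cov M j)ᶜ} := by
      rw [Fintype.card_coe, card_compl, cov_card hM]
      simp; omega
    obtain ⟨φ⟩ := Function.Embedding.nonempty_of_card_le h1
    refine ⟨fun p => (φ p).1, fun a b hab => φ.injective (Subtype.ext hab), fun p => ?_⟩
    exact mem_compl.mp (φ p).2
  choose u0 hu0inj hu0cov using hemb
  set u : Fin k × Fin k → Fin k → α := fun p j => u0 j p with hu
  have hucov : ∀ p j, ∀ e ∈ M, u p j ≠ e j := fun p j e he h =>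
    hu0cov j p (mem_cov.mpr ⟨e, he, h.symm⟩)
  have huinj : ∀ p q j, u p j = u q j → p = q := fun p q j h => hu0inj j h
  clear_value u
  have hk' : (0 : ℝ) < k := by exact_mod_cast hk
  set n : ℝ := (Fintype.card α : ℝ) with hndef
  have hn0 : 0 ≤ n := by positivity
  set N := M \ M0 with hN
  have hNM : N ⊆ M := sdiff_subset
  set G : Fin k → Fin k → Finset (Fin k → α) :=
    fun i s => N.filter (fun e => update (u (i, s)) i (e i) ∈ E) with hG
  have hGM : ∀ i s, G i s ⊆ M := fun i s => (filter_subset _ _).trans hNM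
  have hGcard : ∀ i s, n / k - δ * n ≤ ((G i s).card : ℝ) := by
    intro i s
    have h1 := hE (u (i, s)) i
    have h2 : cnt (fun v => update (u (i, s)) i v ∈ E) ≤
        cnt (fun v => v ∈ cov (G i s) i) + cnt (fun v => v ∈ cov M0 i) := by
      apply cnt_le_add
      intro v hv
      by_cases hvc : v ∈ cov M i
      · obtain ⟨e, he, rfl⟩ := mem_cov.mp hvc
        by_cases he0 : e ∈ M0
        · right; exact mem_cov.mpr ⟨e, he0, rfl⟩
        · left; exact mem_cov.mpr ⟨e, by simp [hG, hN, he, he0, hv], rfl⟩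
      · exfalso
        have h3 := mat_insert hk hM (e := update (u (i, s)) i v) (by
          intro f hf l
          by_cases hl : l = i
          · subst hl
            simp only [update_self]
            intro h; exact hvc (mem_cov.mpr ⟨f, hf, h.symm⟩)
          · rw [update_of_ne hl]; exact hucov _ _ f hf)
        have := hmax _ h3.1 (insert_subset hv hME) (hM0M.trans (subset_insert _ _))
        omega
    rw [cnt_mem, cnt_mem] at h2
    have h3 : ((cov (G i s) i).card : ℝ) ≤ (G i s).card := by exact_mod_cast cov_card_le _ _
    have h4 : ((cov M0 i).card : ℝ) ≤ M0.card := by exact_mod_cast cov_card_le _ _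
    linarith
  have hGdisj : ∀ i j s t e, i ≠ j → e ∈ G i s → e ∈ G j t → False := by
    intro i j s t e hij h1 h2
    have heM := hGM i s h1
    have heN : e ∉ M0 := (mem_sdiff.mp (mem_filter.mp h1).1).2
    obtain ⟨M', hM', hM'E, hc, hsub, -⟩ := two_hit hk hM hME heM (mem_filter.mp h1).2
      (mem_filter.mp h2).2 (by
        intro l
        by_cases hl : l = i
        · subst hl
          rw [update_self, update_of_ne hij]
          exact (hucov _ _ e heM).symm
        · rw [update_of_ne hl]
          by_cases hl' : l = j
          · subst hl'
            rw [update_self]; exact hucov _ _ e heM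
          · rw [update_of_ne hl']
            intro h
            have := huinj _ _ _ h
            simp only [Prod.mk.injEq] at this
            exact hij this.1) (by
        intro f hf l h
        by_cases hl : l = i
        · subst hl
          rw [update_self] at h; exact (hM e heM f hf _ h).symm
        · rw [update_of_ne hl] at h; exact absurd h (hucov _ _ f hf)) (by
        intro f hf l h
        by_cases hl : l = j
        · subst hl
          rw [update_self] at h; exact (hM e heM f hf _ h).symm
        · rw [update_of_ne hl] at h; exact absurd h (hucov _ _ f hf))
    have := hmax M' hM' hM'E (by
      intro x hx
      exact hsub (mem_erase.mpr ⟨fun h => heN (h ▸ hx), hM0M hx⟩))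
    omega
  set I : Fin k → Finset (Fin k → α) := fun i => univ.biUnion (G i) with hI
  have hmemI : ∀ i e, e ∈ I i ↔ ∃ s, e ∈ G i s := by intro i e; simp [hI]
  have hIdisj : ∀ i j, i ≠ j → Disjoint (I i) (I j) := by
    intro i j hij
    rw [disjoint_left]
    intro e h1 h2
    obtain ⟨s, hs⟩ := (hmemI i e).mp h1
    obtain ⟨t, ht⟩ := (hmemI j e).mp h2
    exact hGdisj i j s t e hij hs ht
  have hIM : ∀ i, I i ⊆ M := by
    intro i e he
    obtain ⟨s, hs⟩ := (hmemI i e).mp he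
    exact hGM i s hs
  let z : Fin k := ⟨0, hk⟩
  have hIlow : ∀ i, n / k - δ * n ≤ ((I i).card : ℝ) := by
    intro i
    refine (hGcard i z).trans ?_
    exact_mod_cast card_le_card (fun e he => (hmemI i e).mpr ⟨z, he⟩)
  have hMn : (M.card : ℝ) ≤ n := by rw [hndef]; exact_mod_cast mat_card_le hM z
  have hIsum : ∑ i, ((I i).card : ℝ) ≤ n := by
    have : (univ.biUnion I).card = ∑ i, (I i).card :=
      card_biUnion (fun i _ j _ hij => hIdisj i j hij)
    have h2 : (univ.biUnion I).card ≤ M.card :=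
      card_le_card (biUnion_subset.mpr (fun i _ => hIM i))
    rw [this] at h2
    refine le_trans ?_ hMn
    exact_mod_cast h2
  have hIup : ∀ i, ((I i).card : ℝ) ≤ n / k + k * δ * n := by
    intro i
    rw [← add_sum_erase univ _ (mem_univ i)] at hIsum
    have h1 : ∑ j ∈ univ.erase i, (n / k - δ * n) ≤ ∑ j ∈ univ.erase i, ((I j).card : ℝ) :=
      sum_le_sum (fun j _ => hIlow j)
    rw [sum_const, card_erase_of_mem (mem_univ i), nsmul_eq_mul, card_univ, Fintype.card_fin,
      Nat.cast_sub hk] at h1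
    have h2 : (k : ℝ) * (n / k) = n := by field_simp
    have h3 : 0 ≤ δ * n := by positivity
    push_cast at h1
    nlinarith
  set Gd : Fin k → Finset (Fin k → α) := fun i => (I i).filter (fun e => ∀ s, e ∈ G i s) with hGd
  have hGdlow : ∀ i, n / k - δ * n - k * ((k + 1) * δ * n) ≤ ((Gd i).card : ℝ) := by
    intro i
    have h1 : I i ⊆ Gd i ∪ univ.biUnion (fun s => I i \ G i s) := by
      intro e he
      by_cases h : ∀ s, e ∈ G i s
      · simp only [mem_union, hGd, mem_filter]; exact Or.inl ⟨he, h⟩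
      · push Not at h
        obtain ⟨s, hs⟩ := h
        simp only [mem_union, mem_biUnion, mem_sdiff]
        exact Or.inr ⟨s, mem_univ _, he, hs⟩
    have h2 := (card_le_card h1).trans ((card_union_le _ _).trans
      (Nat.add_le_add_left card_biUnion_le _))
    have h3 : ((I i).card : ℝ) ≤ (Gd i).card + ∑ s, ((I i \ G i s).card : ℝ) := by
      exact_mod_cast h2
    have h4 : ∑ s, ((I i \ G i s).card : ℝ) ≤ ∑ s : Fin k, (k + 1) * δ * n := by
      apply sum_le_sum
      intro s _
      have hsub : G i s ⊆ I i := fun e he => (hmemI i e).mpr ⟨s, he⟩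
      rw [card_sdiff_of_subset hsub, Nat.cast_sub (card_le_card hsub)]
      have := hIup i
      have := hGcard i s
      linarith
    simp only [sum_const, card_univ, Fintype.card_fin, nsmul_eq_mul] at h4
    have := hIlow i
    linarith
  have hGdI : ∀ i, Gd i ⊆ I i := fun i => filter_subset _ _
  have hGdM : ∀ i, Gd i ⊆ M := fun i => (hGdI i).trans (hIM i)
  have hsubMat : ∀ X ⊆ M, Mat X := fun X hX a ha b hb i h => hM a (hX ha) b (hX hb) i h
  have hδn : 0 ≤ δ * n := by positivity
  have hk1 : (1 : ℝ) ≤ k := by exact_mod_cast hk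
  refine ⟨fun i => cov (Gd i) i, ?_, ?_⟩
  · intro i
    rw [cov_card (hsubMat _ (hGdM i)), abs_le]
    have h1 := hGdlow i
    have h2 := hIup i
    have h3 : ((Gd i).card : ℝ) ≤ (I i).card := by exact_mod_cast card_le_card (hGdI i)
    have h4 : (1 + k * (k + 1)) * (δ * n) ≤ k * ((1 + k * (k + 1)) * (δ * n)) := by
      have : 0 ≤ (1 + (k : ℝ) * (k + 1)) * (δ * n) := by positivity
      nlinarith
    have h5 : k * (δ * n) ≤ k * ((1 + k * (k + 1)) * (δ * n)) := by
      have : 0 ≤ (k : ℝ) * (k + 1) * (δ * n) := by positivity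
      nlinarith
    constructor <;> linarith
  · set U := univ.biUnion Gd with hU
    have hUM : U ⊆ M := biUnion_subset.mpr (fun i _ => hGdM i)
    have hUcard : (U.card : ℝ) = ∑ i, ((Gd i).card : ℝ) := by
      rw [hU, card_biUnion (fun i _ j _ hij => (hIdisj i j hij).mono (hGdI i) (hGdI j))]
      push_cast; rfl
    have hWcard : ∀ j, (((cov U j)ᶜ).card : ℝ) ≤ k * (1 + k * (k + 1)) * δ * n := by
      intro j
      rw [card_compl, Nat.cast_sub (card_le_univ _), cov_card (hsubMat _ hUM), hUcard]
      have h1 : ∑ i : Fin k, (n / k - δ * n - k * ((k + 1) * δ * n)) ≤ ∑ i, ((Gd i).card : ℝ) :=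
        sum_le_sum (fun i _ => hGdlow i)
      rw [sum_const, card_univ, Fintype.card_fin, nsmul_eq_mul] at h1
      have h2 : (k : ℝ) * (n / k) = n := by field_simp
      nlinarith
    refine le_trans (cnt_mono ?_) (count_touch (fun j => (cov U j)ᶜ) _ hWcard)
    rintro f ⟨hfE, hfA⟩
    by_contra hcon
    push Not at hcon
    have hcon' : ∀ j, ∃ e ∈ U, e j = f j := fun j => mem_cov.mp (by simpa using hcon j)
    choose c hcU hcf using hcon'
    have hτ : ∀ e, ∃ i, e ∈ U → e ∈ Gd i := by
      intro e
      by_cases he : e ∈ U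
      · obtain ⟨i, -, hi⟩ := mem_biUnion.mp he
        exact ⟨i, fun _ => hi⟩
      · exact ⟨z, fun h => absurd h he⟩
    choose τ hτ using hτ
    set F := univ.image c with hF
    have hFU : F ⊆ U := by
      intro e he
      obtain ⟨j, -, rfl⟩ := mem_image.mp he
      exact hcU j
    have hs : ∀ e, ∃ j, e ∈ F → c j = e := by
      intro e
      by_cases he : e ∈ F
      · obtain ⟨j, -, hj⟩ := mem_image.mp he
        exact ⟨j, fun _ => hj⟩
      · exact ⟨z, fun h => absurd h he⟩
    choose s hs using hs
    have hFM := hFU.trans hUM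
    set h : (Fin k → α) → (Fin k → α) :=
      fun e => update (u (τ e, s e)) (τ e) (e (τ e)) with hh
    have hhE : ∀ e ∈ F, h e ∈ E := by
      intro e he
      have := (mem_filter.mp (hτ e (hFU he))).2 (s e)
      exact (mem_filter.mp this).2
    have hinj : ∀ e ∈ F, ∀ e' ∈ F, ∀ l, h e l = h e' l → e = e' := by
      intro e he e' he' l hl
      by_cases h1 : l = τ e <;> by_cases h2 : l = τ e'
      · simp only [hh] at hl
        rw [← h1, ← h2, update_self, update_self] at hl
        exact hM e (hFM he) e' (hFM he') l hl
      · simp only [hh] at hl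
        rw [update_of_ne h2, ← h1, update_self] at hl
        exact absurd hl.symm (hucov _ _ e (hFM he))
      · simp only [hh] at hl
        rw [update_of_ne h1, ← h2, update_self] at hl
        exact absurd hl (hucov _ _ e' (hFM he'))
      · simp only [hh] at hl
        rw [update_of_ne h1, update_of_ne h2] at hl
        have := huinj _ _ _ hl
        simp only [Prod.mk.injEq] at this
        rw [← hs e he, ← hs e' he', this.2]
    have hmatF : Mat (F.image h) := by
      intro a ha b hb l hl
      obtain ⟨e, he, rfl⟩ := mem_image.mp ha
      obtain ⟨e', he', rfl⟩ := mem_image.mp hb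
      rw [hinj e he e' he' l hl]
    have hcardF : (F.image h).card = F.card := by
      apply card_image_of_injOn
      intro a ha b hb hab
      exact hinj a ha b hb z (congrFun hab z)
    have hG' := mat_insert hk hmatF (e := f) (by
      intro g hg l hl
      obtain ⟨e, he, rfl⟩ := mem_image.mp hg
      by_cases h1 : l = τ e
      · simp only [hh] at hl
        rw [← h1, update_self] at hl
        have hmem := hτ e (hFU he)
        rw [← h1] at hmem
        exact hfA l (mem_cov.mpr ⟨e, hmem, hl.symm⟩)
      · simp only [hh] at hl
        rw [update_of_ne h1, ← hcf l] at hl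
        exact absurd hl.symm (hucov _ _ _ (hUM (hcU l))))
    have hsw := swap hk hM hFM hG'.1 (by
      intro g hg e he l hl
      rcases mem_insert.mp hg with rfl | hg
      · rw [← hcf l] at hl
        rw [← hM _ (hUM (hcU l)) e he l hl]
        exact mem_image_of_mem _ (mem_univ l)
      · obtain ⟨e', he', rfl⟩ := mem_image.mp hg
        by_cases h1 : l = τ e'
        · simp only [hh] at hl
          rw [← h1, update_self] at hl
          rw [← hM _ (hFM he') e he l hl]; exact he'
        · simp only [hh] at hl
          rw [update_of_ne h1] at hl
          exact absurd hl (hucov _ _ e he))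
    have hfin := hmax _ hsw.1 (by
      intro x hx
      simp only [mem_union, mem_sdiff, mem_insert, mem_image] at hx
      rcases hx with hx | rfl | ⟨e, he, rfl⟩
      · exact hME hx.1
      · exact hfE
      · exact hhE e he) (by
      intro x hx
      apply mem_union_left
      rw [mem_sdiff]
      refine ⟨hM0M hx, fun hxF => ?_⟩
      have h1 := (mem_filter.mp (hτ x (hFU hxF))).2 z
      exact (mem_sdiff.mp (mem_filter.mp h1).1).2 hx)
    have h3 := hsw.2
    rw [hG'.2.2, hcardF] at h3
    omega


lemma miss_bound (hk : 0 < k) {E : Finset (Fin k → α)} (hE : Deg E) (l : Fin k)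
    (A : Finset α) {m : ℝ} (hA : (A.card : ℝ) - Fintype.card α / k ≤ m)
    (R : (Fin k → α) → Prop) (hR : ∀ f v, R (update f l v) ↔ R f) :
    Fintype.card α * cnt (fun f => R f ∧ f l ∈ A ∧ f ∉ E) ≤
      m * cnt R + Fintype.card α * cnt (fun f => R f ∧ f l ∉ A ∧ f ∈ E) := by
  rw [fiber (fun f => R f ∧ f l ∈ A ∧ f ∉ E) l, fiber (fun f => R f ∧ f l ∉ A ∧ f ∈ E) l,
    cnt_sum R, mul_sum, ← sum_add_distrib]
  apply sum_le_sum
  intro f _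
  simp only [hR, update_self]
  by_cases hf : R f
  · simp only [hf, true_and, if_true, mul_one]
    have h1 := cnt_split (fun v => v ∈ A) (fun v => update f l v ∈ E)
    have h2 := cnt_split (fun v => update f l v ∈ E) (fun v => v ∈ A)
    have h3 : cnt (fun v => update f l v ∈ E ∧ v ∈ A) = cnt (fun v => v ∈ A ∧ update f l v ∈ E) :=
      cnt_congr (fun v => and_comm)
    have h4 : cnt (fun v => update f l v ∈ E ∧ v ∉ A) = cnt (fun v => v ∉ A ∧ update f l v ∈ E) :=
      cnt_congr (fun v => and_comm)
    have h5 := hE f l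
    rw [cnt_mem] at h1
    linarith
  · have h0 : cnt (fun _ : α => False) = 0 := by simp [cnt_sum]
    simp [hf, h0]

lemma markov (hk : 0 < k) (hn : 0 < Fintype.card α) (X : Finset α) (i : Fin k)
    (P : (Fin k → α) → Prop) {s t : ℝ} (ht : 0 < t)
    (hX : ∀ v ∈ X, t * (Fintype.card α : ℝ) ^ (k - 1) ≤ cnt (fun f => f i = v ∧ P f))
    (hP : cnt P ≤ s * (Fintype.card α : ℝ) ^ k) :
    (X.card : ℝ) ≤ s / t * Fintype.card α := by
  have hn' : (0 : ℝ) < Fintype.card α := by exact_mod_cast hn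
  have hpow : (Fintype.card α : ℝ) ^ (k - 1) * Fintype.card α = (Fintype.card α : ℝ) ^ k := by
    rw [← pow_succ]; congr 1; omega
  set n : ℝ := (Fintype.card α : ℝ)
  have h1 := cnt_fiber P (fun f : Fin k → α => f i)
  have h2 : ∑ v ∈ X, t * n ^ (k - 1) ≤ ∑ v : α, cnt (fun f => f i = v ∧ P f) :=
    (sum_le_sum hX).trans (sum_le_sum_of_subset_of_nonneg (subset_univ _)
      (fun _ _ _ => cnt_nonneg _))
  rw [← h1, sum_const, nsmul_eq_mul] at h2
  have hpos : 0 < t * n ^ (k - 1) := by positivity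
  have h3 : (X.card : ℝ) * (t * n ^ (k - 1)) ≤ (s / t * n) * (t * n ^ (k - 1)) := by
    calc _ ≤ _ := h2
      _ ≤ _ := hP
      _ = _ := by rw [← hpow]; field_simp
  exact le_of_mul_le_mul_right h3 hpos

lemma count_box (i : Fin k) (v : α) (S : Fin k → Finset α) {b : ℝ} (hb : 0 ≤ b)
    (hS : ∀ j, b ≤ ((S j).card : ℝ)) :
    b ^ (k - 1) ≤ cnt (fun f : Fin k → α => f i = v ∧ ∀ j, j ≠ i → f j ∈ S j) := by
  have h1 : cnt (fun f : Fin k → α => f i = v ∧ ∀ j, j ≠ i → f j ∈ S j) =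
      cnt (fun f : Fin k → α => ∀ j, f j ∈ if j = i then {v} else S j) := by
    apply cnt_congr
    intro f
    constructor
    · rintro ⟨h1, h2⟩ j
      split_ifs with h
      · subst h; simp [h1]
      · exact h2 j h
    · intro h
      refine ⟨by simpa using h i, fun j hj => ?_⟩
      have := h j
      rwa [if_neg hj] at this
  rw [h1, cnt_eq, count_pi, ← mul_prod_erase univ _ (mem_univ i)]
  simp only [if_true, card_singleton, one_mul]
  push_cast
  calc b ^ (k - 1) = ∏ j ∈ univ.erase i, b := by simp
    _ ≤ _ := by
      apply prod_le_prod
      · intros; exact hb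
      · intro j hj
        rw [if_neg (mem_erase.mp hj).1]; exact hS j

/-- `f` has exactly one vertex in `A`, namely in class `l` -/
def Ty (A : Fin k → Finset α) (l : Fin k) (f : Fin k → α) : Prop :=
  f l ∈ A l ∧ ∀ j, j ≠ l → f j ∉ A j

lemma clean (hk : 3 ≤ k) (hn : 0 < Fintype.card α) {E : Finset (Fin k → α)} (hE : Deg E)
    (A : Fin k → Finset α) {θ η : ℝ} (hθ : 0 < θ) (hθ' : θ ≤ (1 / 2) ^ k) (hη : 0 ≤ η)
    (hη' : η ≤ 1 / 6)
    (hA : ∀ i, |((A i).card : ℝ) - Fintype.card α / k| ≤ η * Fintype.card α)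
    (hB : cnt (fun f => f ∈ E ∧ ∀ j, f j ∉ A j) ≤ η * (Fintype.card α : ℝ) ^ k) :
    ∃ A' : Fin k → Finset α,
      (∀ i, |((A' i).card : ℝ) - Fintype.card α / k| ≤ (η + 2 * η / θ) * Fintype.card α) ∧
      (∀ i, ∀ v ∈ A' i, (θ - k * (2 * η / θ)) * (Fintype.card α : ℝ) ^ (k - 1) ≤
        cnt (fun f => f i = v ∧ f ∈ E ∧ Ty A' i f)) ∧
      (∀ i, ∀ v, v ∉ A' i → cnt (fun f => f i = v ∧ f ∈ E ∧ ∀ j, f j ∉ A' j) ≤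
        (θ + k * (2 * η / θ)) * (Fintype.card α : ℝ) ^ (k - 1)) ∧
      cnt (fun f => f ∈ E ∧ ∀ j, f j ∉ A' j) ≤
        (η + k * (2 * η / θ)) * (Fintype.card α : ℝ) ^ k := by
  have hn' : (0 : ℝ) < Fintype.card α := by exact_mod_cast hn
  have hpow : (Fintype.card α : ℝ) ^ (k - 1) * Fintype.card α = (Fintype.card α : ℝ) ^ k := by
    rw [← pow_succ]; congr 1; omega
  have hpow2 : (Fintype.card α : ℝ) ^ (k - 2) * Fintype.card α
      = (Fintype.card α : ℝ) ^ (k - 1) := by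
    rw [← pow_succ]; congr 1; omega
  set n : ℝ := (Fintype.card α : ℝ) with hndef
  set ν : ℝ := 2 * η / θ with hν
  have hν0 : 0 ≤ ν := by positivity
  have hk3 : (3 : ℝ) ≤ k := by exact_mod_cast hk
  set A' : Fin k → Finset α := fun i => univ.filter (fun v =>
    θ * n ^ (k - 1) ≤ cnt (fun f => f i = v ∧ f ∈ E ∧ ∀ j, j ≠ i → f j ∉ A j)) with hA'
  have hmemA' : ∀ i v, v ∈ A' i ↔
      θ * n ^ (k - 1) ≤ cnt (fun f => f i = v ∧ f ∈ E ∧ ∀ j, j ≠ i → f j ∉ A j) := by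
    intro i v; simp [hA']
  clear_value A'
  have hd1 : ∀ i, ((A' i \ A i).card : ℝ) ≤ ν * n := by
    intro i
    have h1 := markov (by omega) hn (A' i \ A i) i (fun f => f ∈ E ∧ ∀ j, f j ∉ A j) hθ (by
      intro v hv
      rw [mem_sdiff] at hv
      refine ((hmemA' i v).mp hv.1).trans (cnt_mono ?_)
      rintro f ⟨h1, h2, h3⟩
      refine ⟨h1, h2, fun j => ?_⟩
      by_cases hj : j = i
      · subst hj; rw [h1]; exact hv.2
      · exact h3 j hj) hB
    refine h1.trans ?_
    rw [hν]
    gcongr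
    linarith
  have hmiss : ∀ i, cnt (fun f => (∀ j, j ≠ i → f j ∉ A j) ∧ f i ∈ A i ∧ f ∉ E) ≤ 2 * η * n ^ k := by
    intro i
    have h1 := miss_bound (by omega) hE i (A i) (le_of_abs_le (hA i))
      (fun f => ∀ j, j ≠ i → f j ∉ A j) (by
        intro f v
        refine forall_congr' fun j => forall_congr' fun hj => ?_
        rw [update_of_ne hj])
    have h2 : cnt (fun f : Fin k → α => ∀ j, j ≠ i → f j ∉ A j) ≤ n ^ k := cnt_le_all _
    have h3 : cnt (fun f => (∀ j, j ≠ i → f j ∉ A j) ∧ f i ∉ A i ∧ f ∈ E) ≤ η * n ^ k := by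
      refine (cnt_mono ?_).trans hB
      rintro f ⟨h1, h2, h3⟩
      refine ⟨h3, fun j => ?_⟩
      by_cases hj : j = i
      · subst hj; exact h2
      · exact h1 j hj
    have h4 : n * cnt (fun f => (∀ j, j ≠ i → f j ∉ A j) ∧ f i ∈ A i ∧ f ∉ E) ≤
        n * (2 * η * n ^ k) := by
      calc _ ≤ _ := h1
        _ ≤ η * n * n ^ k + n * (η * n ^ k) := by gcongr
        _ = _ := by ring
    exact le_of_mul_le_mul_left h4 hn'
  have hBc : ∀ j, n / 2 ≤ (((A j)ᶜ).card : ℝ) := by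
    intro j
    rw [card_compl, Nat.cast_sub (card_le_univ _)]
    have h1 := le_of_abs_le (hA j)
    have h2 : n / k ≤ n / 3 := by gcongr
    have h3 : η * n ≤ 1 / 6 * n := by gcongr
    linarith
  have hd2 : ∀ i, ((A i \ A' i).card : ℝ) ≤ ν * n := by
    intro i
    refine markov (by omega) hn (A i \ A' i) i
      (fun f => (∀ j, j ≠ i → f j ∉ A j) ∧ f i ∈ A i ∧ f ∉ E) hθ ?_ (hmiss i)
    intro v hv
    rw [mem_sdiff, hmemA', not_le] at hv
    have h1 := count_box i v (fun j => (A j)ᶜ) (by positivity) hBc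
    have h2 : cnt (fun f : Fin k → α => f i = v ∧ ∀ j, j ≠ i → f j ∈ (A j)ᶜ) ≤
        cnt (fun f => f i = v ∧ f ∈ E ∧ ∀ j, j ≠ i → f j ∉ A j) +
        cnt (fun f => f i = v ∧ (∀ j, j ≠ i → f j ∉ A j) ∧ f i ∈ A i ∧ f ∉ E) := by
      apply cnt_le_add
      rintro f ⟨h1, h2⟩
      have h2' : ∀ j, j ≠ i → f j ∉ A j := fun j hj => mem_compl.mp (h2 j hj)
      by_cases hf : f ∈ E
      · exact Or.inl ⟨h1, hf, h2'⟩
      · exact Or.inr ⟨h1, h2', by rw [h1]; exact hv.1, hf⟩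
    have h3 : 2 * θ * n ^ (k - 1) ≤ (n / 2) ^ (k - 1) := by
      have h4 : (1 / 2 : ℝ) ^ k = (1 / 2) * (1 / 2) ^ (k - 1) := by
        rw [← pow_succ']; congr 1; omega
      have h5 : 2 * θ ≤ (1 / 2) ^ (k - 1) := by linarith
      calc _ ≤ (1 / 2) ^ (k - 1) * n ^ (k - 1) := by gcongr
        _ = _ := by rw [← mul_pow]; congr 1; ring
    linarith [hv.2]
  refine ⟨A', ?_, ?_, ?_, ?_⟩
  · intro i
    have h1 := abs_le.mp (hA i)
    have h2 : ((A' i).card : ℝ) ≤ (A i).card + (A' i \ A i).card := by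
      rw [← cnt_mem, ← cnt_mem, ← cnt_mem]
      apply cnt_le_add
      intro x hx
      by_cases h : x ∈ A i <;> simp [h, hx]
    have h3 : ((A i).card : ℝ) ≤ (A' i).card + (A i \ A' i).card := by
      rw [← cnt_mem, ← cnt_mem, ← cnt_mem]
      apply cnt_le_add
      intro x hx
      by_cases h : x ∈ A' i <;> simp [h, hx]
    have := hd1 i
    have := hd2 i
    rw [abs_le]
    constructor <;> linarith
  · intro i v hv
    have h1 := (hmemA' i v).mp hv
    have h2 := count_touch_at i v (fun j => A' j \ A j) _ hd1
    have h3 : cnt (fun f => f i = v ∧ f ∈ E ∧ ∀ j, j ≠ i → f j ∉ A j) ≤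
        cnt (fun f => f i = v ∧ f ∈ E ∧ Ty A' i f) +
        cnt (fun f : Fin k → α => f i = v ∧ ∃ j, j ≠ i ∧ f j ∈ A' j \ A j) := by
      apply cnt_le_add
      rintro f ⟨h1, h2, h3⟩
      by_cases hf : ∃ j, j ≠ i ∧ f j ∈ A' j \ A j
      · exact Or.inr ⟨h1, hf⟩
      · left
        refine ⟨h1, h2, by rw [h1]; exact hv, fun j hj hfj => hf ⟨j, hj, ?_⟩⟩
        exact mem_sdiff.mpr ⟨hfj, h3 j hj⟩
    have h4 : k * (ν * n) * n ^ (k - 2) = k * ν * n ^ (k - 1) := by rw [← hpow2]; ring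
    linarith
  · intro i v hv
    have h1 : ¬ _ := fun h => hv ((hmemA' i v).mpr h)
    rw [not_le] at h1
    have h2 := count_touch_at i v (fun j => A j \ A' j) _ hd2
    have h3 : cnt (fun f => f i = v ∧ f ∈ E ∧ ∀ j, f j ∉ A' j) ≤
        cnt (fun f => f i = v ∧ f ∈ E ∧ ∀ j, j ≠ i → f j ∉ A j) +
        cnt (fun f : Fin k → α => f i = v ∧ ∃ j, j ≠ i ∧ f j ∈ A j \ A' j) := by
      apply cnt_le_add
      rintro f ⟨h1, h2, h3⟩
      by_cases hf : ∃ j, j ≠ i ∧ f j ∈ A j \ A' j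
      · exact Or.inr ⟨h1, hf⟩
      · left
        refine ⟨h1, h2, fun j hj hfj => hf ⟨j, hj, ?_⟩⟩
        exact mem_sdiff.mpr ⟨hfj, h3 j⟩
    have h4 : k * (ν * n) * n ^ (k - 2) = k * ν * n ^ (k - 1) := by rw [← hpow2]; ring
    linarith
  · have h2 := count_touch (fun j => A j \ A' j) _ hd2
    have h3 : cnt (fun f => f ∈ E ∧ ∀ j, f j ∉ A' j) ≤
        cnt (fun f => f ∈ E ∧ ∀ j, f j ∉ A j) + cnt (fun f : Fin k → α => ∃ j, f j ∈ A j \ A' j) := by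
      apply cnt_le_add
      rintro f ⟨h2, h3⟩
      by_cases hf : ∃ j, f j ∈ A j \ A' j
      · exact Or.inr hf
      · left
        refine ⟨h2, fun j hfj => hf ⟨j, ?_⟩⟩
        exact mem_sdiff.mpr ⟨hfj, h3 j⟩
    have h4 : k * (ν * n) * n ^ (k - 1) = k * ν * n ^ k := by rw [← hpow]; ring
    linarith

/-- The cleaned extremal structure. -/
structure Str (E : Finset (Fin k → α)) (A : Fin k → Finset α) (θ μ : ℝ) : Prop where
  size : ∀ i, |((A i).card : ℝ) - Fintype.card α / k| ≤ μ * Fintype.card α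
  deg : ∀ i, ∀ v ∈ A i, θ / 2 * (Fintype.card α : ℝ) ^ (k - 1) ≤
    cnt (fun f => f i = v ∧ f ∈ E ∧ Ty A i f)
  missB : ∀ l i, i ≠ l → ∀ v, v ∉ A i → cnt (fun f => f i = v ∧ Ty A l f ∧ f ∉ E) ≤
    2 * θ * (Fintype.card α : ℝ) ^ (k - 1)
  bad : ∀ i, ∃ X : Finset α, (X.card : ℝ) ≤ μ * Fintype.card α ∧ X ⊆ A i ∧
    ∀ v ∈ A i, v ∉ X → cnt (fun f => f i = v ∧ Ty A i f ∧ f ∉ E) ≤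
      2 * θ * (Fintype.card α : ℝ) ^ (k - 1)

lemma clean2 (hk : 3 ≤ k) (hn : 0 < Fintype.card α) {E : Finset (Fin k → α)} (hE : Deg E)
    (A : Fin k → Finset α) {θ η : ℝ} (hθ : 0 < θ) (hθ' : θ ≤ (1 / 2) ^ k)
    (hη : η = θ ^ 3 / (1000 * k ^ 4))
    (hA : ∀ i, |((A i).card : ℝ) - Fintype.card α / k| ≤ η * Fintype.card α)
    (hB : cnt (fun f => f ∈ E ∧ ∀ j, f j ∉ A j) ≤ η * (Fintype.card α : ℝ) ^ k) :
    ∃ A' : Fin k → Finset α, Str E A' θ (θ / (100 * k ^ 2)) := by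
  have hk3 : (3 : ℝ) ≤ k := by exact_mod_cast hk
  have hk0 : (0 : ℝ) < k := by linarith
  have hθ1 : θ ≤ 1 := hθ'.trans (pow_le_one₀ (by norm_num) (by norm_num))
  have hη0 : 0 ≤ η := by rw [hη]; positivity
  have hη1 : η ≤ 1 / 6 := by
    rw [hη, div_le_iff₀ (by positivity)]
    have h1 : θ ^ 3 ≤ 1 := pow_le_one₀ hθ.le hθ1
    have h2 : (1 : ℝ) ≤ k ^ 4 := one_le_pow₀ (by linarith)
    linarith
  obtain ⟨A', h1, h2, h3, h4⟩ := clean hk hn hE A hθ hθ' hη0 hη1 hA hB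
  have hn' : (0 : ℝ) < Fintype.card α := by exact_mod_cast hn
  have hpow : (Fintype.card α : ℝ) ^ (k - 1) * Fintype.card α = (Fintype.card α : ℝ) ^ k := by
    rw [← pow_succ]; congr 1; omega
  set n : ℝ := (Fintype.card α : ℝ) with hndef
  set ν : ℝ := 2 * η / θ with hν
  have hν2 : ν = θ ^ 2 / (500 * k ^ 4) := by rw [hν, hη]; field_simp; norm_num
  have hν0 : 0 ≤ ν := by positivity
  have hην : 2 * η ≤ ν := by
    rw [hν, le_div_iff₀ hθ]; nlinarith
  have hkν : k * ν ≤ θ * (θ / (100 * k ^ 2)) / 4 := by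
    rw [hν2, ← sub_nonneg]
    have : θ * (θ / (100 * k ^ 2)) / 4 - k * (θ ^ 2 / (500 * k ^ 4))
      = θ ^ 2 / (2000 * k ^ 3) * (5 * k - 4) := by field_simp; ring
    rw [this]
    have : (0 : ℝ) ≤ 5 * k - 4 := by linarith
    positivity
  set μ : ℝ := θ / (100 * k ^ 2) with hμ
  have hμ0 : 0 < μ := by positivity
  have hμ1 : μ ≤ 1 := by
    rw [hμ, div_le_one (by positivity)]; nlinarith
  have hkν2 : k * ν ≤ θ / 4 := by nlinarith
  have hkν3 : k * ν ≤ μ / 4 := by nlinarith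
  have hνk : 3 * ν ≤ k * ν := by gcongr
  refine ⟨A', ?_, ?_, ?_, ?_⟩
  · intro i
    refine (h1 i).trans ?_
    gcongr
    linarith
  · intro i v hv
    refine le_trans ?_ (h2 i v hv)
    gcongr
    linarith
  · intro l i hil v hv
    have a1 := miss_bound (by omega) hE l (A' l) (le_of_abs_le (h1 l))
      (fun f => f i = v ∧ ∀ j, j ≠ l → f j ∉ A' j) (by
        intro f w
        rw [update_of_ne hil]
        refine and_congr_right fun _ => forall_congr' fun j => forall_congr' fun hj => ?_
        rw [update_of_ne hj])
    have a2 : cnt (fun f : Fin k → α => f i = v ∧ ∀ j, j ≠ l → f j ∉ A' j) ≤ n ^ (k - 1) := by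
      rw [hndef, ← count_at i v]; exact cnt_mono (fun f hf => hf.1)
    have a3 : cnt (fun f => (f i = v ∧ ∀ j, j ≠ l → f j ∉ A' j) ∧ f l ∉ A' l ∧ f ∈ E) ≤
        (θ + k * ν) * n ^ (k - 1) := by
      refine le_trans (cnt_mono ?_) (h3 i v hv)
      rintro f ⟨⟨b1, b2⟩, b3, b4⟩
      refine ⟨b1, b4, fun j => ?_⟩
      by_cases hj : j = l
      · subst hj; exact b3
      · exact b2 j hj
    have a4 : cnt (fun f => f i = v ∧ Ty A' l f ∧ f ∉ E) ≤
        cnt (fun f => (f i = v ∧ ∀ j, j ≠ l → f j ∉ A' j) ∧ f l ∈ A' l ∧ f ∉ E) :=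
      cnt_mono (fun f hf => ⟨⟨hf.1, hf.2.1.2⟩, hf.2.1.1, hf.2.2⟩)
    have a5 : n * cnt (fun f => f i = v ∧ Ty A' l f ∧ f ∉ E) ≤ n * (2 * θ * n ^ (k - 1)) := by
      calc _ ≤ n * cnt (fun f => (f i = v ∧ ∀ j, j ≠ l → f j ∉ A' j) ∧ f l ∈ A' l ∧ f ∉ E) := by
            gcongr
        _ ≤ _ := a1
        _ ≤ (η + ν) * n * n ^ (k - 1) + n * ((θ + k * ν) * n ^ (k - 1)) := by gcongr
        _ = n * ((η + ν + θ + k * ν) * n ^ (k - 1)) := by ring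
        _ ≤ _ := by gcongr; linarith
    exact le_of_mul_le_mul_left a5 hn'
  · intro i
    refine ⟨(A' i).filter (fun v => ¬ cnt (fun f => f i = v ∧ Ty A' i f ∧ f ∉ E) ≤
      2 * θ * n ^ (k - 1)), ?_, filter_subset _ _, ?_⟩
    · have a1 := miss_bound (by omega) hE i (A' i) (le_of_abs_le (h1 i))
        (fun f => ∀ j, j ≠ i → f j ∉ A' j) (by
          intro f w
          refine forall_congr' fun j => forall_congr' fun hj => ?_
          rw [update_of_ne hj])
      have a2 : cnt (fun f : Fin k → α => ∀ j, j ≠ i → f j ∉ A' j) ≤ n ^ k := cnt_le_all _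
      have a3 : cnt (fun f => (∀ j, j ≠ i → f j ∉ A' j) ∧ f i ∉ A' i ∧ f ∈ E) ≤
          (η + k * ν) * n ^ k := by
        refine le_trans (cnt_mono ?_) h4
        rintro f ⟨b2, b3, b4⟩
        refine ⟨b4, fun j => ?_⟩
        by_cases hj : j = i
        · subst hj; exact b3
        · exact b2 j hj
      have a4 : cnt (fun f => Ty A' i f ∧ f ∉ E) ≤
          cnt (fun f => (∀ j, j ≠ i → f j ∉ A' j) ∧ f i ∈ A' i ∧ f ∉ E) :=
        cnt_mono (fun f hf => ⟨hf.1.2, hf.1.1, hf.2⟩)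
      have a5 : n * cnt (fun f => Ty A' i f ∧ f ∉ E) ≤ n * (2 * k * ν * n ^ k) := by
        calc _ ≤ n * cnt (fun f => (∀ j, j ≠ i → f j ∉ A' j) ∧ f i ∈ A' i ∧ f ∉ E) := by
              gcongr
          _ ≤ _ := a1
          _ ≤ (η + ν) * n * n ^ k + n * ((η + k * ν) * n ^ k) := by gcongr
          _ = n * ((η + ν + η + k * ν) * n ^ k) := by ring
          _ ≤ _ := by gcongr; linarith
      have a6 := le_of_mul_le_mul_left a5 hn'
      have a7 := markov (k := k) (by omega) hn (i := i) (P := fun f : Fin k → α => Ty A' i f ∧ f ∉ E)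
        (t := 2 * θ) (ht := by positivity) (X := (A' i).filter (fun v => ¬ cnt (fun f => f i = v ∧ Ty A' i f ∧ f ∉ E) ≤
          2 * θ * n ^ (k - 1))) (by
          intro v hv
          exact (not_le.mp (mem_filter.mp hv).2).le) a6
      refine a7.trans ?_
      gcongr
      rw [div_le_iff₀ (by positivity)]
      linarith
    · intro v hv hvX
      by_contra hcon
      exact hvX (mem_filter.mpr ⟨hv, hcon⟩)



lemma cnt_le_sum {β ι : Type} [Fintype β] [Fintype ι] {P : β → Prop} {Q : ι → β → Prop}
    (h : ∀ x, P x → ∃ t, Q t x) : cnt P ≤ ∑ t, cnt (Q t) := by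
  have h1 : (univ.filter P) ⊆ univ.biUnion (fun t => univ.filter (Q t)) := by
    intro f hf
    simp only [mem_filter, mem_univ, true_and, mem_biUnion] at hf ⊢
    exact h f hf
  have h2 := (card_le_card h1).trans card_biUnion_le
  simp only [cnt_eq]
  exact_mod_cast h2

lemma cnt_inj {β γ : Type} [Fintype β] [Fintype γ] {P : β → Prop} {Q : γ → Prop} (g : β → γ)
    (h : ∀ x, P x → Q (g x)) (hg : Injective g) : cnt P ≤ cnt Q := by
  simp only [cnt_eq]
  exact_mod_cast card_le_card_of_injOn g (by intro x hx; simpa using h x (by simpa using hx)) hg.injOn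

lemma count_coll {β : Type} [Fintype β] {z a b : Fin k} (hab : a ≠ b) (x0 : β) :
    (Fintype.card β : ℝ) * cnt (fun y : Fin k → β => y z = x0 ∧ y a = y b) ≤
      (Fintype.card β : ℝ) ^ (k - 1) := by
  have key : ∀ a b : Fin k, a ≠ b → b ≠ z →
    (Fintype.card β : ℝ) * cnt (fun y : Fin k → β => y z = x0 ∧ y a = y b) ≤
      (Fintype.card β : ℝ) ^ (k - 1) := by
    intro a b hab hb
    rw [fiber _ b, ← count_at z x0, cnt_sum (fun f : Fin k → β => f z = x0)]
    apply sum_le_sum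
    intro f _
    simp only [update_self, update_of_ne hab, update_of_ne hb.symm]
    by_cases h : f z = x0
    · simp only [h, true_and, if_true]
      rw [cnt_eq]
      have : (univ.filter (fun v => f a = v)).card ≤ 1 := by
        rw [card_le_one]; intro x hx y hy; simp at hx hy; rw [← hx, ← hy]
      exact_mod_cast this
    · simp [h, cnt_sum]
  by_cases hb : b = z
  · have ha : a ≠ z := fun h => hab (h.trans hb.symm)
    refine le_trans (le_of_eq ?_) (key b a hab.symm ha)
    congr 1
    exact cnt_congr (fun y => by rw [eq_comm (a := y a)])
  · exact key a b hab hb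

lemma find_y [NeZero k] {E N : Finset (Fin k → α)} {A : Fin k → Finset α} (hN : Mat N)
    {l : Fin k} {x0 : Fin k → α} (hx0 : x0 ∈ N) (hx0l : Ty A l x0) {c : ℝ}
    (hc : ∀ t, cnt (fun f => f t = x0 t ∧ Ty A l f ∧ f ∉ E) ≤ c)
    (hm : (4 * k ^ 2 : ℝ) ≤ (N.filter (Ty A l)).card)
    (hm2 : 4 * k * c ≤ ((N.filter (Ty A l)).card : ℝ) ^ (k - 1)) :
    ∃ y : Fin k → Fin k → α, Injective y ∧ y 0 = x0 ∧ (∀ a, y a ∈ N ∧ Ty A l (y a)) ∧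
      ∀ t, (fun j => y (t - j) j) ∈ E := by
  set β := {e // e ∈ N.filter (Ty A l)} with hβ
  have hk : 0 < k := Nat.pos_of_ne_zero (NeZero.ne k)
  have hk' : (0 : ℝ) < k := by exact_mod_cast hk
  have hcard : Fintype.card β = (N.filter (Ty A l)).card := Fintype.card_coe _
  rw [← hcard] at hm hm2
  set m : ℝ := (Fintype.card β : ℝ) with hmdef
  have hm0 : 0 < m := lt_of_lt_of_le (by positivity) hm
  let b0 : β := ⟨x0, mem_filter.mpr ⟨hx0, hx0l⟩⟩
  have hβN : ∀ b : β, b.1 ∈ N ∧ Ty A l b.1 := fun b => mem_filter.mp b.2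
  by_contra hcon
  push Not at hcon
  have h1 : cnt (fun y : Fin k → β => y 0 = b0) ≤
      cnt (fun y : Fin k → β => y 0 = b0 ∧ ∃ t, (fun j => (y (t - j)).1 j) ∉ E) +
      cnt (fun y : Fin k → β => y 0 = b0 ∧ ∃ a b, a ≠ b ∧ y a = y b) := by
    apply cnt_le_add
    intro y hy
    by_cases hinj : Injective y
    · left
      refine ⟨hy, ?_⟩
      exact hcon (fun a => (y a).1) (fun a b h => hinj (Subtype.ext h)) (by rw [hy])
        (fun a => hβN _)
    · right
      refine ⟨hy, ?_⟩
      simp only [Injective] at hinj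
      push Not at hinj
      obtain ⟨a, b, h1, h2⟩ := hinj
      exact ⟨a, b, h2, h1⟩
  have h2 : cnt (fun y : Fin k → β => y 0 = b0 ∧ ∃ t, (fun j => (y (t - j)).1 j) ∉ E) ≤ k * c := by
    calc _ ≤ ∑ t : Fin k, cnt (fun y : Fin k → β => y 0 = b0 ∧ (fun j => (y (t - j)).1 j) ∉ E) :=
          cnt_le_sum (fun y ⟨h, t, ht⟩ => ⟨t, h, ht⟩)
      _ ≤ ∑ t : Fin k, c := by
          apply sum_le_sum
          intro t _
          refine le_trans ?_ (hc t)
          refine cnt_inj (fun y j => (y (t - j)).1 j) ?_ ?_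
          · rintro y ⟨h, ht⟩
            refine ⟨?_, ⟨?_, ?_⟩, ht⟩
            · simp only [sub_self, h, b0]
            · exact (hβN _).2.1
            · intro j hj
              exact (hβN _).2.2 j hj
          · intro y y' h
            funext a
            have := congrFun h (t - a)
            simp only [sub_sub_cancel] at this
            exact Subtype.ext (hN _ (hβN _).1 _ (hβN _).1 _ this)
      _ = _ := by simp
  have h3 : m * cnt (fun y : Fin k → β => y 0 = b0 ∧ ∃ a b, a ≠ b ∧ y a = y b) ≤
      k ^ 2 * m ^ (k - 1) := by
    calc _ ≤ m * ∑ p : Fin k × Fin k, cnt (fun y : Fin k → β => p.1 ≠ p.2 ∧ y 0 = b0 ∧ y p.1 = y p.2) := by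
          gcongr
          exact cnt_le_sum (fun y ⟨h, a, b, hab, h'⟩ => ⟨(a, b), hab, h, h'⟩)
      _ = ∑ p : Fin k × Fin k, m * cnt (fun y : Fin k → β => p.1 ≠ p.2 ∧ y 0 = b0 ∧ y p.1 = y p.2) := by
          rw [mul_sum]
      _ ≤ ∑ p : Fin k × Fin k, m ^ (k - 1) := by
          apply sum_le_sum
          intro p _
          by_cases hp : p.1 = p.2
          · simp only [hp, ne_eq, not_true_eq_false, false_and]
            have : cnt (fun _ : Fin k → β => False) = 0 := by simp [cnt_sum]
            rw [this, mul_zero]; positivity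
          · refine le_trans ?_ (count_coll hp b0 (z := 0))
            gcongr
            exact cnt_mono (fun y h => h.2)
      _ = _ := by
          rw [sum_const, card_univ, Fintype.card_prod, Fintype.card_fin, nsmul_eq_mul]
          push_cast; ring
  rw [count_at] at h1
  have h5 : 0 < m ^ (k - 1) := by positivity
  have h4 : cnt (fun y : Fin k → β => y 0 = b0 ∧ ∃ a b, a ≠ b ∧ y a = y b) ≤ m ^ (k - 1) / 4 := by
    have : m * cnt (fun y : Fin k → β => y 0 = b0 ∧ ∃ a b, a ≠ b ∧ y a = y b) ≤
        m * (m ^ (k - 1) / 4) := by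
      refine h3.trans ?_
      nlinarith
    exact le_of_mul_le_mul_left this hm0
  have h6 : m ^ (k - 1) ≤ k * c + m ^ (k - 1) / 4 := by
    refine le_trans ?_ (h1.trans (add_le_add h2 h4))
    rw [hmdef]
  linarith

lemma improve [NeZero k] {E N : Finset (Fin k → α)} {A : Fin k → Finset α} (hN : Mat N)
    {l : Fin k} {x0 : Fin k → α} (hx0 : x0 ∈ N) (hx0E : x0 ∉ E)
    {y : Fin k → Fin k → α} (hy : Injective y) (hy0 : y 0 = x0) (hyN : ∀ a, y a ∈ N ∧ Ty A l (y a))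
    (hyE : ∀ t, (fun j => y (t - j) j) ∈ E) :
    ∃ N', Mat N' ∧ N'.card = N.card ∧ (∀ e ∈ N', ∀ j, ∃ e' ∈ N, e j = e' j) ∧
      ((∀ e ∈ N, ∃ l, Ty A l e) → ∀ e ∈ N', ∃ l, Ty A l e) ∧
      (N.filter (· ∈ E)).card < (N'.filter (· ∈ E)).card := by
  have hk : 0 < k := Nat.pos_of_ne_zero (NeZero.ne k)
  set g : Fin k → Fin k → α := fun t j => y (t - j) j with hg
  have hgg : ∀ s t i, g s i = g t i → s = t := by
    intro s t i h
    have := hy (hN _ (hyN _).1 _ (hyN _).1 i h)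
    exact sub_left_injective this
  have hginj : Injective g := fun s t h => hgg s t 0 (by rw [h])
  set F := univ.image y with hF
  set G := univ.image g with hG
  have hFc : F.card = k := by rw [hF, card_image_of_injective _ hy]; simp
  have hGc : G.card = k := by rw [hG, card_image_of_injective _ hginj]; simp
  have hFN : F ⊆ N := by
    intro e he; simp only [hF, mem_image, mem_univ, true_and] at he
    obtain ⟨a, rfl⟩ := he; exact (hyN a).1
  have hGM : Mat G := by
    intro a ha b hb i h
    simp only [hG, mem_image, mem_univ, true_and] at ha hb
    obtain ⟨s, rfl⟩ := ha
    obtain ⟨t, rfl⟩ := hb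
    rw [hgg s t i h]
  have hGE : G ⊆ E := by
    intro e he; simp only [hG, mem_image, mem_univ, true_and] at he
    obtain ⟨a, rfl⟩ := he; exact hyE a
  have hsw := swap hk hN hFN hGM (by
    intro e he f hf i h
    simp only [hG, mem_image, mem_univ, true_and] at he
    obtain ⟨t, rfl⟩ := he
    have := hN _ (hyN _).1 f hf i h
    rw [← this]; simp [hF])
  refine ⟨_, hsw.1, by have := hsw.2; omega, ?_, ?_, ?_⟩
  · intro e he j
    rw [mem_union, mem_sdiff] at he
    rcases he with he | he
    · exact ⟨e, he.1, rfl⟩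
    · simp only [hG, mem_image, mem_univ, true_and] at he
      obtain ⟨t, rfl⟩ := he
      exact ⟨_, (hyN (t - j)).1, rfl⟩
  · intro h e he
    rw [mem_union, mem_sdiff] at he
    rcases he with he | he
    · exact h e he.1
    · simp only [hG, mem_image, mem_univ, true_and] at he
      obtain ⟨t, rfl⟩ := he
      exact ⟨l, (hyN _).2.1, fun j hj => (hyN _).2.2 j hj⟩
  · have h1 : (N.filter (· ∈ E)) ⊆ ((N \ F).filter (· ∈ E)) ∪ (F.erase x0) := by
      intro e he
      rw [mem_filter] at he
      by_cases heF : e ∈ F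
      · exact mem_union_right _ (mem_erase.mpr ⟨fun h => hx0E (h ▸ he.2), heF⟩)
      · exact mem_union_left _ (mem_filter.mpr ⟨mem_sdiff.mpr ⟨he.1, heF⟩, he.2⟩)
    have h2 : (F.erase x0).card = k - 1 := by
      rw [card_erase_of_mem, hFc]; rw [← hy0]; simp [hF]
    have h3 : ((N \ F) ∪ G).filter (· ∈ E) = ((N \ F).filter (· ∈ E)) ∪ G := by
      rw [filter_union, filter_true_of_mem (fun x hx => hGE hx)]
    have h4 : Disjoint ((N \ F).filter (· ∈ E)) G := by
      rw [disjoint_left]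
      intro e he heG
      simp only [hG, mem_image, mem_univ, true_and] at heG
      obtain ⟨t, rfl⟩ := heG
      rw [mem_filter, mem_sdiff] at he
      have := hN _ (hyN (t - 0)).1 _ he.1.1 0 rfl
      apply he.1.2
      rw [← this]; simp [hF]
    have h5 := (card_le_card h1).trans (card_union_le _ _)
    rw [h3, card_union_of_disjoint h4, hGc]
    omega

lemma init_match (hk : 0 < k) {Q : Finset (Fin k → α)} (hQ : Mat Q) (A : Fin k → Finset α)
    (hsum : ∑ i, (A i \ cov Q i).card + Q.card = Fintype.card α) :
    ∃ N, Mat N ∧ N.card + Q.card = Fintype.card α ∧ (∀ e ∈ N, ∀ j, e j ∉ cov Q j) ∧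
      ∀ e ∈ N, ∃ l, Ty A l e := by
  let I := Σ i : Fin k, {v // v ∈ A i \ cov Q i}
  have hI : Fintype.card I = ∑ i, (A i \ cov Q i).card := by
    rw [Fintype.card_sigma]
    exact sum_congr rfl (fun i _ => Fintype.card_coe _)
  have hφ : ∀ j : Fin k, ∃ g : I → α, Injective g ∧ (∀ x, g x ∉ cov Q j) ∧
      ∀ x, g x ∈ A j ↔ x.1 = j := by
    intro j
    have h1 : Fintype.card I = ((cov Q j)ᶜ).card := by
      rw [card_compl, cov_card hQ]; omega
    obtain ⟨g, hg⟩ := exists_equiv_extend_of_card_eq h1 (s := univ.filter (fun x : I => x.1 = j))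
      (f := fun x => x.2.1) (by
        intro v hv
        simp only [mem_image, mem_filter, mem_univ, true_and] at hv
        obtain ⟨⟨i, x⟩, rfl, rfl⟩ := hv
        exact mem_compl.mpr (mem_sdiff.mp x.2).2) (by
        rintro ⟨i, x⟩ hx ⟨i', x'⟩ hx' h
        simp only [coe_filter, mem_univ, true_and, Set.mem_ofPred_eq] at hx hx'
        subst hx
        subst hx'
        simp only at h
        rw [Subtype.ext h])
    refine ⟨fun x => (g x).1, fun x y h => g.injective (Subtype.ext h),
      fun x => mem_compl.mp (g x).2, fun x => ⟨fun h => ?_, fun h => ?_⟩⟩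
    · let x' : I := ⟨j, ⟨(g x).1, mem_sdiff.mpr ⟨h, mem_compl.mp (g x).2⟩⟩⟩
      have h2 := hg x' (by simp [x'])
      have h3 : g x' = g x := Subtype.ext h2
      have h4 := g.injective h3
      rw [← h4]
    · show (g x).1 ∈ A j
      rw [hg x (by simpa using h)]
      subst h
      exact (mem_sdiff.mp x.2.2).1
  choose g hg1 hg2 hg3 using hφ
  have hinj : Injective (fun (x : I) (j : Fin k) => g j x) := fun x y h =>
    hg1 ⟨0, hk⟩ (congrFun h ⟨0, hk⟩)
  refine ⟨univ.image (fun (x : I) (j : Fin k) => g j x), ?_, ?_, ?_, ?_⟩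
  · intro a ha b hb i h
    simp only [mem_image, mem_univ, true_and] at ha hb
    obtain ⟨x, rfl⟩ := ha
    obtain ⟨x', rfl⟩ := hb
    rw [hg1 i h]
  · rw [card_image_of_injective _ hinj, card_univ, hI, hsum]
  · intro e he j
    simp only [mem_image, mem_univ, true_and] at he
    obtain ⟨x, rfl⟩ := he
    exact hg2 j x
  · intro e he
    simp only [mem_image, mem_univ, true_and] at he
    obtain ⟨x, rfl⟩ := he
    exact ⟨x.1, (hg3 _ x).mpr rfl, fun j hj h => hj ((hg3 j x).mp h).symm⟩

lemma finish (hk : 0 < k) {E Q : Finset (Fin k → α)} (hQ : Mat Q) (A : Fin k → Finset α)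
    (hsum : ∑ i, (A i \ cov Q i).card + Q.card = Fintype.card α) {c : ℝ}
    (hmiss : ∀ l i v, v ∉ cov Q i → (v ∈ A i ↔ i = l) →
      cnt (fun f => f i = v ∧ Ty A l f ∧ f ∉ E) ≤ c)
    (hm : ∀ i, (4 * k ^ 2 : ℝ) ≤ (A i \ cov Q i).card)
    (hm2 : ∀ i, 4 * k * c ≤ ((A i \ cov Q i).card : ℝ) ^ (k - 1)) :
    ∃ M ⊆ E, Mat M ∧ Fintype.card α ≤ M.card + (Q.filter (· ∉ E)).card := by
  haveI : NeZero k := ⟨by omega⟩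
  obtain ⟨N0, h0⟩ := init_match hk hQ A hsum
  obtain ⟨N, hNmem, hNmax⟩ := exists_max_image ((univ : Finset (Finset (Fin k → α))).filter
    (fun N => Mat N ∧ N.card + Q.card = Fintype.card α ∧ (∀ e ∈ N, ∀ j, e j ∉ cov Q j) ∧
      ∀ e ∈ N, ∃ l, Ty A l e)) (fun N => (N.filter (· ∈ E)).card) ⟨N0, by simpa using h0⟩
  simp only [mem_filter, mem_univ, true_and] at hNmem hNmax
  obtain ⟨hN, hNc, hNQ, hNT⟩ := hNmem
  have hNE : N ⊆ E := by
    intro x0 hx0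
    by_contra hx0E
    obtain ⟨l, hl⟩ := hNT x0 hx0
    have hcard : (A l \ cov Q l).card ≤ (N.filter (Ty A l)).card := by
      refine (card_le_card ?_).trans (cov_card_le (N.filter (Ty A l)) l)
      intro v hv
      rw [mem_sdiff] at hv
      have h1 : cov N l = (cov Q l)ᶜ := by
        apply eq_of_subset_of_card_le
        · intro w hw
          obtain ⟨e, he, rfl⟩ := mem_cov.mp hw
          exact mem_compl.mpr (hNQ e he l)
        · rw [card_compl, cov_card hN, cov_card hQ]; omega
      have h2 : v ∈ cov N l := by rw [h1]; exact mem_compl.mpr hv.2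
      obtain ⟨e, he, rfl⟩ := mem_cov.mp h2
      obtain ⟨l', hl'⟩ := hNT e he
      have : l = l' := by
        by_contra hne
        exact hl'.2 l hne hv.1
      subst this
      exact mem_cov.mpr ⟨e, mem_filter.mpr ⟨he, hl'⟩, rfl⟩
    have hcard' : ((A l \ cov Q l).card : ℝ) ≤ (N.filter (Ty A l)).card := by exact_mod_cast hcard
    obtain ⟨y, hy1, hy2, hy3, hy4⟩ := find_y hN hx0 hl (E := E) (c := c) (by
      intro t
      refine hmiss l t _ (hNQ x0 hx0 t) ⟨fun h => ?_, fun h => ?_⟩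
      · by_contra hne; exact hl.2 t hne h
      · rw [h]; exact hl.1) ((hm l).trans hcard') ((hm2 l).trans (by gcongr))
    obtain ⟨N', a1, a2, a3, a4, a5⟩ := improve hN hx0 hx0E hy1 hy2 hy3 hy4
    have := hNmax N' ⟨a1, by omega, by
      intro e he j
      obtain ⟨e', he', h⟩ := a3 e he j
      rw [h]; exact hNQ e' he' j, a4 hNT⟩
    omega
  have hsw := swap hk (M := Q.filter (· ∈ E)) (F := ∅) (G := N) (by
    intro a ha b hb i h
    exact hQ a (mem_filter.mp ha).1 b (mem_filter.mp hb).1 i h) (empty_subset _) hN (by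
    intro e he f hf i h
    exact absurd (mem_cov.mpr ⟨f, (mem_filter.mp hf).1, h.symm⟩) (hNQ e he i))
  refine ⟨_, ?_, hsw.1, ?_⟩
  · intro e he
    simp only [sdiff_empty, mem_union, mem_filter] at he
    rcases he with he | he
    · exact he.2
    · exact hNE he
  · have h1 := hsw.2
    have h2 := card_filter_add_card_filter_not (s := Q) (· ∈ E)
    rw [card_empty] at h1
    omega


/-- number of vertices of `e` in `A` -/
noncomputable def cA (A : Fin k → Finset α) (e : Fin k → α) : ℕ :=
  (univ.filter (fun i => e i ∈ A i)).card

lemma cA_zero {A : Fin k → Finset α} {e : Fin k → α} (h : ∀ j, e j ∉ A j) : cA A e = 0 := by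
  simp [cA, h]

lemma cA_one {A : Fin k → Finset α} {e : Fin k → α} {l : Fin k} (h : Ty A l e) : cA A e = 1 := by
  rw [cA, card_eq_one]
  refine ⟨l, ?_⟩
  ext i
  simp only [mem_filter, mem_univ, true_and, mem_singleton]
  constructor
  · intro hi; by_contra hne; exact h.2 i hne hi
  · rintro rfl; exact h.1

lemma sum_cA {Q : Finset (Fin k → α)} (hQ : Mat Q) (A : Fin k → Finset α) :
    ∑ i, (A i \ cov Q i).card + ∑ e ∈ Q, cA A e = ∑ i, (A i).card := by
  have h1 : ∑ e ∈ Q, cA A e = ∑ i, (A i ∩ cov Q i).card := by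
    have : ∀ i, (A i ∩ cov Q i).card = (Q.filter (fun e => e i ∈ A i)).card := by
      intro i
      rw [← card_image_of_injOn (f := fun e : Fin k → α => e i) (s := Q.filter (fun e => e i ∈ A i))]
      · congr 1
        ext v
        simp only [mem_inter, mem_cov, mem_image, mem_filter]
        constructor
        · rintro ⟨h, e, he, rfl⟩; exact ⟨e, ⟨he, h⟩, rfl⟩
        · rintro ⟨e, ⟨he, h⟩, rfl⟩; exact ⟨h, e, he, rfl⟩
      · intro a ha b hb h
        simp only [coe_filter, Set.mem_ofPred_eq] at ha hb
        exact hQ a ha.1 b hb.1 i h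
    simp only [this, cA, card_filter]
    rw [sum_comm]
  rw [h1, ← sum_add_distrib]
  exact sum_congr rfl (fun i _ => card_sdiff_add_card_inter _ _)

lemma few (hk : 0 < k) {E : Finset (Fin k → α)} (hE : Deg E) (A : Fin k → Finset α) {q : ℕ}
    (hq : ∑ i, (A i).card + q = Fintype.card α)
    (hroom : ∀ j, (A j).card + q + k ≤ Fintype.card α) :
    ∃ Q ⊆ E, Mat Q ∧ Q.card = q ∧ ∀ e ∈ Q, ∀ j, e j ∉ A j := by
  set EB := E.filter (fun e => ∀ j, e j ∉ A j) with hEB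
  obtain ⟨M, hMmem, hMmax⟩ := exists_max_image (EB.powerset.filter (fun M => Mat M))
    (fun M => M.card) ⟨∅, mem_filter.mpr ⟨by simp, by simp [Mat]⟩⟩
  simp only [mem_filter, mem_powerset] at hMmem hMmax
  obtain ⟨hME, hM⟩ := hMmem
  have hmemB : ∀ e, e ∈ EB ↔ e ∈ E ∧ ∀ j, e j ∉ A j := by intro e; simp [hEB]
  by_cases hdone : q ≤ M.card
  · obtain ⟨Q, hQM, hQc⟩ := exists_subset_card_eq hdone
    exact ⟨Q, fun e he => ((hmemB e).mp (hME (hQM he))).1,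
      fun a ha b hb => hM a (hQM ha) b (hQM hb), hQc,
      fun e he => ((hmemB e).mp (hME (hQM he))).2⟩
  exfalso
  push Not at hdone
  have hemb : ∀ j : Fin k, ∃ u : Fin k → α, Injective u ∧ ∀ p, u p ∉ cov M j ∧ u p ∉ A j := by
    intro j
    have h1 : Fintype.card (Fin k) ≤ Fintype.card {v // v ∈ (cov M j ∪ A j)ᶜ} := by
      rw [Fintype.card_coe, card_compl, Fintype.card_fin]
      have := card_union_le (cov M j) (A j)
      have := cov_card hM j
      have := hroom j
      omega
    obtain ⟨φ⟩ := Function.Embedding.nonempty_of_card_le h1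
    refine ⟨fun p => (φ p).1, fun a b hab => φ.injective (Subtype.ext hab), fun p => ?_⟩
    have := mem_compl.mp (φ p).2
    rw [mem_union] at this
    tauto
  choose u0 hu0inj hu0cov using hemb
  set u : Fin k → Fin k → α := fun p j => u0 j p with hu
  have hucov : ∀ p j, ∀ e ∈ M, u p j ≠ e j := fun p j e he h =>
    (hu0cov j p).1 (mem_cov.mpr ⟨e, he, h.symm⟩)
  have huA : ∀ p j, u p j ∉ A j := fun p j => (hu0cov j p).2
  have huinj : ∀ p q j, u p j = u q j → p = q := fun p q j h => hu0inj j h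
  have huB : ∀ i v, v ∉ A i → update (u i) i v ∈ E → update (u i) i v ∈ EB := by
    intro i v hv h
    refine (hmemB _).mpr ⟨h, fun j => ?_⟩
    by_cases hj : j = i
    · subst hj; rwa [update_self]
    · rw [update_of_ne hj]; exact huA i j
  clear_value u
  have hk' : (0 : ℝ) < k := by exact_mod_cast hk
  set G : Fin k → Finset (Fin k → α) :=
    fun i => M.filter (fun e => update (u i) i (e i) ∈ E) with hG
  have hGcard : ∀ i, (Fintype.card α : ℝ) / k ≤ ((G i).card : ℝ) + (A i).card := by
    intro i
    refine (hE (u i) i).trans ?_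
    have h2 : cnt (fun v => update (u i) i v ∈ E) ≤
        cnt (fun v => v ∈ cov (G i) i) + cnt (fun v => v ∈ A i) := by
      apply cnt_le_add
      intro v hv
      by_cases hvA : v ∈ A i
      · exact Or.inr hvA
      left
      by_cases hvc : v ∈ cov M i
      · obtain ⟨e, he, rfl⟩ := mem_cov.mp hvc
        exact mem_cov.mpr ⟨e, by simp [hG, he, hv], rfl⟩
      · exfalso
        have h3 := mat_insert hk hM (e := update (u i) i v) (by
          intro f hf l
          by_cases hl : l = i
          · subst hl
            simp only [update_self]
            intro h; exact hvc (mem_cov.mpr ⟨f, hf, h.symm⟩)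
          · rw [update_of_ne hl]; exact hucov _ _ f hf)
        have := hMmax _ ⟨insert_subset (huB i v hvA hv) hME, h3.1⟩
        omega
    rw [cnt_mem, cnt_mem] at h2
    have h3 : ((cov (G i) i).card : ℝ) ≤ (G i).card := by exact_mod_cast cov_card_le _ _
    linarith
  have hGdisj : ∀ i j, i ≠ j → Disjoint (G i) (G j) := by
    intro i j hij
    rw [disjoint_left]
    intro e h1 h2
    have heM := (mem_filter.mp h1).1
    have heA := ((hmemB e).mp (hME heM)).2
    obtain ⟨M', hM', hM'E, hc, -, -⟩ := two_hit hk hM hME heM (huB i _ (heA i) (mem_filter.mp h1).2)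
      (huB j _ (heA j) (mem_filter.mp h2).2) (by
        intro l
        by_cases hl : l = i
        · subst hl
          rw [update_self, update_of_ne hij]
          exact (hucov _ _ e heM).symm
        · rw [update_of_ne hl]
          by_cases hl' : l = j
          · subst hl'
            rw [update_self]; exact hucov _ _ e heM
          · rw [update_of_ne hl']
            intro h
            exact hij (huinj _ _ _ h)) (by
        intro f hf l h
        by_cases hl : l = i
        · subst hl
          rw [update_self] at h; exact (hM e heM f hf _ h).symm
        · rw [update_of_ne hl] at h; exact absurd h (hucov _ _ f hf)) (by
        intro f hf l h
        by_cases hl : l = j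
        · subst hl
          rw [update_self] at h; exact (hM e heM f hf _ h).symm
        · rw [update_of_ne hl] at h; exact absurd h (hucov _ _ f hf))
    have := hMmax M' ⟨hM'E, hM'⟩
    omega
  have h1 : ∑ i, (G i).card ≤ M.card := by
    rw [← card_biUnion (fun i _ j _ hij => hGdisj i j hij)]
    exact card_le_card (biUnion_subset.mpr (fun i _ => filter_subset _ _))
  have h2 : (Fintype.card α : ℝ) ≤ ∑ i, ((G i).card : ℝ) + ∑ i, ((A i).card : ℝ) := by
    rw [← sum_add_distrib]
    calc (Fintype.card α : ℝ) = ∑ i : Fin k, (Fintype.card α : ℝ) / k := by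
          simp; field_simp
      _ ≤ _ := sum_le_sum (fun i _ => hGcard i)
  have h3 : Fintype.card α ≤ ∑ i, (G i).card + ∑ i, (A i).card := by exact_mod_cast h2
  omega

lemma many (hk : 3 ≤ k) {E : Finset (Fin k → α)} (hE : Deg E) (A : Fin k → Finset α) (s : ℕ)
    (h1 : ∀ i, s < (A i).card) (h2 : ∀ i, (A i).card + s < Fintype.card α)
    (h3 : (s : ℝ) < Fintype.card α / k) :
    ∃ Q ⊆ E, Mat Q ∧ Q.card ≤ s ∧
      (∑ e ∈ Q, cA A e = Q.card + s ∨ ∑ e ∈ Q, cA A e = Q.card + s + 1) := by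
  induction s with
  | zero => exact ⟨∅, by simp, by simp [Mat], by simp, by simp⟩
  | succ s ih =>
    obtain ⟨Q, hQE, hQ, hQc, hs⟩ := ih (fun i => by have := h1 i; omega)
      (fun i => by have := h2 i; omega) (by push_cast at h3; linarith)
    rcases hs with hs | hs
    swap
    · exact ⟨Q, hQE, hQ, by omega, Or.inl (by omega)⟩
    have hA : ∀ i, ∃ v ∈ A i, v ∉ cov Q i := by
      intro i
      by_contra hcon
      push Not at hcon
      have := card_le_card (fun v hv => hcon v hv : A i ⊆ cov Q i)
      have := cov_card hQ i
      have := h1 i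
      omega
    have hB : ∀ i, ∃ v, v ∉ A i ∧ v ∉ cov Q i := by
      intro i
      by_contra hcon
      push Not at hcon
      have h4 : (univ : Finset α) ⊆ A i ∪ cov Q i := by
        intro v _
        rw [mem_union]
        by_cases hv : v ∈ A i
        · exact Or.inl hv
        · exact Or.inr (hcon v hv)
      have := (card_le_card h4).trans (card_union_le _ _)
      rw [card_univ] at this
      have := cov_card hQ i
      have := h2 i
      omega
    choose a ha using hA
    choose b hb using hB
    let z0 : Fin k := ⟨0, by omega⟩
    let z1 : Fin k := ⟨1, by omega⟩
    let z2 : Fin k := ⟨2, by omega⟩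
    have h01 : z0 ≠ z1 := by simp [z0, z1]
    have h02 : z0 ≠ z2 := by simp [z0, z2]
    have h12 : z1 ≠ z2 := by simp [z1, z2]
    let f0 : Fin k → α := fun j => if j = z0 ∨ j = z1 then a j else b j
    have hf0 : ∀ j, f0 j ∉ cov Q j := by
      intro j
      simp only [f0]
      split_ifs
      · exact (ha j).2
      · exact (hb j).2
    have hv : ∃ v, update f0 z2 v ∈ E ∧ v ∉ cov Q z2 := by
      have h4 := hE f0 z2
      have h5 := cnt_split (fun v => update f0 z2 v ∈ E) (fun v => v ∈ cov Q z2)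
      have h6 : cnt (fun v => update f0 z2 v ∈ E ∧ v ∈ cov Q z2) ≤ s := by
        refine (cnt_mono (fun v h => h.2)).trans ?_
        rw [cnt_mem, cov_card hQ]; exact_mod_cast hQc
      push_cast at h3
      exact cnt_exists (by linarith)
    obtain ⟨v, hvE, hvc⟩ := hv
    set e := update f0 z2 v with he
    have hec : ∀ j, e j ∉ cov Q j := by
      intro j
      by_cases hj : j = z2
      · subst hj; rw [he, update_self]; exact hvc
      · rw [he, update_of_ne hj]; exact hf0 j
    have hins := mat_insert (by omega) hQ (e := e) (fun f hf i h =>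
      hec i (mem_cov.mpr ⟨f, hf, h.symm⟩))
    have he0 : e z0 ∈ A z0 := by
      rw [he, update_of_ne h02]; simp only [f0, true_or, if_true]; exact (ha _).1
    have he1 : e z1 ∈ A z1 := by
      rw [he, update_of_ne h12]; simp only [f0, or_true, if_true]; exact (ha _).1
    have hc1 : 2 ≤ cA A e := by
      rw [← card_pair h01]
      apply card_le_card
      intro j hj
      simp only [mem_insert, mem_singleton] at hj
      rcases hj with rfl | rfl
      · simpa using he0
      · simpa using he1
    have hc2 : cA A e ≤ 3 := by
      refine le_trans (card_le_card (t := {z0, z1, z2}) ?_) card_le_three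
      intro j hj
      simp only [mem_filter, mem_univ, true_and] at hj
      simp only [mem_insert, mem_singleton]
      by_contra hcon
      push Not at hcon
      rw [he, update_of_ne hcon.2.2] at hj
      simp only [f0, hcon.1, hcon.2.1, or_self, if_false] at hj
      exact (hb j).1 hj
    refine ⟨insert e Q, insert_subset hvE hQE, hins.1, by omega, ?_⟩
    rw [sum_insert hins.2.1, hins.2.2]
    omega

lemma cover_bad (hk : 3 ≤ k) (hn : 0 < Fintype.card α) {E : Finset (Fin k → α)}
    (A : Fin k → Finset α) {θ W : ℝ}
    (hdeg : ∀ i, ∀ v ∈ A i, θ / 2 * (Fintype.card α : ℝ) ^ (k - 1) ≤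
      cnt (fun f => f i = v ∧ f ∈ E ∧ Ty A i f))
    (hW : k * W < θ / 2 * Fintype.card α)
    {Q : Finset (Fin k → α)} (hQE : Q ⊆ E) (hQ : Mat Q) (T : Finset (Fin k × α))
    (hT : ∀ p ∈ T, p.2 ∈ A p.1) (hTc : (Q.card : ℝ) + T.card ≤ W) :
    ∃ Q' ⊆ E, Mat Q' ∧ Q'.card ≤ Q.card + T.card ∧ (∀ p ∈ T, p.2 ∈ cov Q' p.1) ∧
      ∑ e ∈ Q', cA A e + Q.card = ∑ e ∈ Q, cA A e + Q'.card := by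
  have hn' : (0 : ℝ) < Fintype.card α := by exact_mod_cast hn
  have hpow2 : (Fintype.card α : ℝ) ^ (k - 2) * Fintype.card α
      = (Fintype.card α : ℝ) ^ (k - 1) := by
    rw [← pow_succ]; congr 1; omega
  induction T using Finset.induction_on with
  | empty => exact ⟨Q, hQE, hQ, by simp, by simp, rfl⟩
  | insert p T hp ih =>
    rw [card_insert_of_notMem hp] at hTc ⊢
    push_cast at hTc
    obtain ⟨Q', hQ'E, hQ', hc, hcov, hs⟩ := ih (fun p hp => hT p (mem_insert_of_mem hp))
      (by linarith)
    by_cases hpc : p.2 ∈ cov Q' p.1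
    · refine ⟨Q', hQ'E, hQ', by omega, ?_, hs⟩
      intro x hx
      rcases mem_insert.mp hx with rfl | hx
      · exact hpc
      · exact hcov x hx
    have h1 := hdeg p.1 p.2 (hT p (mem_insert_self _ _))
    have hcW : (Q'.card : ℝ) ≤ W := by
      have : (Q'.card : ℝ) ≤ Q.card + T.card := by exact_mod_cast hc
      linarith
    have h2 := count_touch_at p.1 p.2 (cov Q') W (fun j => by rw [cov_card hQ']; exact hcW)
    have h3 : cnt (fun f : Fin k → α => f p.1 = p.2 ∧ f ∈ E ∧ Ty A p.1 f) ≤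
        cnt (fun f : Fin k → α => (f p.1 = p.2 ∧ f ∈ E ∧ Ty A p.1 f) ∧ ∀ j, f j ∉ cov Q' j) +
        cnt (fun f : Fin k → α => f p.1 = p.2 ∧ ∃ j, j ≠ p.1 ∧ f j ∈ cov Q' j) := by
      apply cnt_le_add
      intro f hf
      by_cases h : ∃ j, j ≠ p.1 ∧ f j ∈ cov Q' j
      · exact Or.inr ⟨hf.1, h⟩
      · refine Or.inl ⟨hf, fun j hj => ?_⟩
        by_cases hjp : j = p.1
        · subst hjp; rw [hf.1] at hj; exact hpc hj
        · exact h ⟨j, hjp, hj⟩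
    have h4 : k * W * (Fintype.card α : ℝ) ^ (k - 2) < θ / 2 * (Fintype.card α : ℝ) ^ (k - 1) := by
      rw [← hpow2]
      have : 0 < (Fintype.card α : ℝ) ^ (k - 2) := by positivity
      nlinarith
    obtain ⟨f, ⟨hf1, hf2, hf3⟩, hf4⟩ := cnt_exists (lt_of_lt_of_le (sub_pos.mpr h4)
      (by linarith : _ ≤ cnt (fun f : Fin k → α => (f p.1 = p.2 ∧ f ∈ E ∧ Ty A p.1 f) ∧
        ∀ j, f j ∉ cov Q' j)))
    have hins := mat_insert (by omega) hQ' (e := f) (fun e he i h =>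
      hf4 i (mem_cov.mpr ⟨e, he, h.symm⟩))
    refine ⟨insert f Q', insert_subset hf2 hQ'E, hins.1, by omega, ?_, ?_⟩
    · intro x hx
      rcases mem_insert.mp hx with rfl | hx
      · exact mem_cov.mpr ⟨f, mem_insert_self _ _, hf1⟩
      · obtain ⟨e, he, h⟩ := mem_cov.mp (hcov x hx)
        exact mem_cov.mpr ⟨e, mem_insert_of_mem he, h⟩
    · rw [sum_insert hins.2.1, hins.2.2, cA_one hf3]
      omega


lemma ext_core (hk : 3 ≤ k) {E : Finset (Fin k → α)} (hE : Deg E) (A : Fin k → Finset α) {θ : ℝ}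
    (hθ : θ = (1 / (2 * k)) ^ (k - 1) / (8 * k)) (hn : 8 * k ^ 3 ≤ Fintype.card α)
    (hS : Str E A θ (θ / (100 * k ^ 2))) :
    ∃ M ⊆ E, Mat M ∧ Fintype.card α ≤ M.card + 1 := by
  have hk3 : (3 : ℝ) ≤ k := by exact_mod_cast hk
  have hk0 : (0 : ℝ) < k := by linarith
  have hn0 : 0 < Fintype.card α := lt_of_lt_of_le (by positivity) hn
  have hn' : (8 * k ^ 3 : ℝ) ≤ Fintype.card α := by exact_mod_cast hn
  set n : ℝ := (Fintype.card α : ℝ) with hndef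
  have hnpos : 0 < n := by rw [hndef]; exact_mod_cast hn0
  have hθ0 : 0 < θ := by rw [hθ]; positivity
  have hθ1 : θ ≤ 1 := by
    rw [hθ, div_le_one (by positivity)]
    have : (1 / (2 * k : ℝ)) ^ (k - 1) ≤ 1 := by
      apply pow_le_one₀ (by positivity)
      rw [div_le_one (by positivity)]; linarith
    linarith
  set x : ℝ := n / k with hx
  have hxn : x * k = n := by rw [hx]; field_simp
  have hx0 : 0 < x := by positivity
  have hx3 : 3 * x ≤ n := by nlinarith
  have hx8 : 8 * (k : ℝ) ^ 2 ≤ x := by rw [hx, le_div_iff₀ hk0]; nlinarith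
  have hxk : 24 * (k : ℝ) ≤ x := by nlinarith
  set μ : ℝ := θ / (100 * k ^ 2) with hμ
  have hμ0 : 0 < μ := by positivity
  set y : ℝ := k * (μ * n) with hy
  have hy0 : 0 < y := by positivity
  have hyθ : 100 * (k * y) = θ * n := by rw [hy, hμ]; field_simp
  have hyx : 100 * y ≤ x := by
    rw [hx, le_div_iff₀ hk0]; nlinarith
  have hμy : 3 * (μ * n) ≤ y := by
    have : 0 < μ * n := by positivity
    rw [hy]; nlinarith
  have hup : ∀ i, ((A i).card : ℝ) ≤ x + y / 3 := by
    intro i; have := (abs_le.mp (hS.size i)).2; linarith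
  have hlo : ∀ i, x - y / 3 ≤ ((A i).card : ℝ) := by
    intro i; have := (abs_le.mp (hS.size i)).1; linarith
  have hsumx : ∑ i : Fin k, x = n := by simp; linarith
  have hsumy : ∑ i : Fin k, μ * n = y := by simp [hy]
  have hsum_up : (∑ i, (A i).card : ℕ) ≤ n + y := by
    push_cast
    rw [← hsumx, ← hsumy, ← sum_add_distrib]
    apply sum_le_sum
    intro i _
    have := (abs_le.mp (hS.size i)).2; linarith
  have hsum_lo : n - y ≤ (∑ i, (A i).card : ℕ) := by
    push_cast
    rw [← hsumx, ← hsumy, ← sum_sub_distrib]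
    apply sum_le_sum
    intro i _
    have := (abs_le.mp (hS.size i)).1; linarith
  -- balancing edges
  obtain ⟨Q1, hQ1E, hQ1, hQ1c, hQ1s⟩ : ∃ Q ⊆ E, Mat Q ∧ (Q.card : ℝ) ≤ y ∧
      (∑ i, (A i).card + Q.card = Fintype.card α + ∑ e ∈ Q, cA A e ∨
       ∑ i, (A i).card + Q.card + 1 = Fintype.card α + ∑ e ∈ Q, cA A e) := by
    rcases le_total (∑ i, (A i).card) (Fintype.card α) with hle | hle
    · obtain ⟨q, hq⟩ := Nat.exists_eq_add_of_le hle
      have hqy : (q : ℝ) ≤ y := by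
        have : n = (∑ i, (A i).card : ℕ) + (q : ℝ) := by rw [hndef, hq]; push_cast; ring
        linarith
      obtain ⟨Q, h1, h2, h3, h4⟩ := few (by omega) hE A hq.symm (by
        intro j
        have := hup j
        have : ((A j).card : ℝ) + q + k ≤ Fintype.card α := by linarith
        exact_mod_cast this)
      refine ⟨Q, h1, h2, by rw [h3]; exact hqy, Or.inl ?_⟩
      rw [sum_eq_zero (fun e he => cA_zero (h4 e he)), h3, hq]; ring
    · obtain ⟨s, hs⟩ := Nat.exists_eq_add_of_le hle
      have hsy : (s : ℝ) ≤ y := by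
        rw [hs] at hsum_up
        push_cast at hsum_up
        linarith
      obtain ⟨Q, h1, h2, h3, h4⟩ := many hk hE A s (by
        intro i
        have := hlo i
        have : (s : ℝ) < (A i).card := by linarith
        exact_mod_cast this) (by
        intro i
        have := hup i
        have : ((A i).card : ℝ) + s < Fintype.card α := by linarith
        exact_mod_cast this) (by linarith)
      have h3' : (Q.card : ℝ) ≤ s := by exact_mod_cast h3
      refine ⟨Q, h1, h2, by linarith, ?_⟩
      omega
  -- bad vertices
  choose X hX1 hX2 hX3 using hS.bad
  set T : Finset (Fin k × α) := univ.filter (fun p => p.2 ∈ X p.1) with hT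
  have hTc : (T.card : ℝ) ≤ y := by
    have h1 : T.card ≤ ∑ i, (X i).card := by
      have : T ⊆ univ.biUnion (fun i => (X i).image (fun v => (i, v))) := by
        rintro ⟨i, v⟩ h
        simp only [hT, mem_filter, mem_univ, true_and] at h
        simp [h]
      exact (card_le_card this).trans (card_biUnion_le.trans
        (sum_le_sum (fun i _ => card_image_le)))
    have h2 : (T.card : ℝ) ≤ ∑ i, ((X i).card : ℝ) := by exact_mod_cast h1
    rw [← hsumy]
    exact h2.trans (sum_le_sum (fun i _ => hX1 i))
  obtain ⟨Q2, hQ2E, hQ2, hQ2c, hQ2T, hQ2s⟩ := cover_bad (W := 2 * y) hk hn0 A hS.deg (by nlinarith)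
    hQ1E hQ1 T (by
      rintro ⟨i, v⟩ h
      simp only [hT, mem_filter, mem_univ, true_and] at h
      exact hX2 i h) (by linarith)
  have hQ2c' : (Q2.card : ℝ) ≤ 2 * y := by
    have : (Q2.card : ℝ) ≤ Q1.card + T.card := by exact_mod_cast hQ2c
    linarith
  have hX2c : ∀ i, X i ⊆ cov Q2 i := by
    intro i v hv
    exact hQ2T (i, v) (by simp [hT, hv])
  -- final correction
  obtain ⟨Q, hQ, hQc, hQX, hQs, hQE⟩ : ∃ Q, Mat Q ∧ (Q.card : ℝ) ≤ 2 * y + 1 ∧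
      (∀ i, X i ⊆ cov Q i) ∧ ∑ i, (A i).card + Q.card = Fintype.card α + ∑ e ∈ Q, cA A e ∧
      (Q.filter (· ∉ E)).card ≤ 1 := by
    rcases hQ1s with h | h
    · refine ⟨Q2, hQ2, by linarith, hX2c, by omega, ?_⟩
      rw [filter_false_of_mem (fun e he => not_not.mpr (hQ2E he))]; simp
    · have hB : ∀ i, ∃ v, v ∉ A i ∧ v ∉ cov Q2 i := by
        intro i
        by_contra hcon
        push Not at hcon
        have h4 : (univ : Finset α) ⊆ A i ∪ cov Q2 i := by
          intro v _
          rw [mem_union]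
          by_cases hv : v ∈ A i
          · exact Or.inl hv
          · exact Or.inr (hcon v hv)
        have h5 := (card_le_card h4).trans (card_union_le _ _)
        rw [card_univ, cov_card hQ2] at h5
        have h6 : n ≤ (A i).card + Q2.card := by rw [hndef]; exact_mod_cast h5
        have := hup i
        linarith
      choose b hb1 hb2 using hB
      have hins := mat_insert (by omega) hQ2 (e := b) (fun e he i h =>
        hb2 i (mem_cov.mpr ⟨e, he, h.symm⟩))
      refine ⟨insert b Q2, hins.1, ?_, ?_, ?_, ?_⟩
      · rw [hins.2.2]; push_cast; linarith
      · intro i v hv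
        obtain ⟨e, he, h⟩ := mem_cov.mp (hX2c i hv)
        exact mem_cov.mpr ⟨e, mem_insert_of_mem he, h⟩
      · rw [sum_insert hins.2.1, hins.2.2, cA_zero hb1]; omega
      · rw [← card_singleton b]
        apply card_le_card
        intro e he
        rw [mem_filter, mem_insert] at he
        rcases he.1 with h | h
        · simp [h]
        · exact absurd (hQ2E h) he.2
  have hsz : ∀ i, x / 2 ≤ ((A i \ cov Q i).card : ℝ) := by
    intro i
    have h1 : ((A i).card : ℝ) ≤ (A i \ cov Q i).card + Q.card := by
      have h2 := card_le_card_sdiff_add_card (s := A i) (t := cov Q i)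
      rw [cov_card hQ] at h2
      exact_mod_cast h2
    have := hlo i
    linarith
  obtain ⟨M, hME, hM, hMc⟩ := finish (E := E) (by omega) hQ A (c := 2 * θ * n ^ (k - 1)) (by
      have := sum_cA hQ A
      omega) (by
      intro l i v hv hvA
      by_cases hil : i = l
      · subst hil
        exact hX3 i v (hvA.mpr rfl) (fun h => hv (hQX i h))
      · exact hS.missB l i hil v (fun h => hil (hvA.mp h))) (by
      intro i
      have := hsz i
      linarith) (by
      intro i
      calc 4 * k * (2 * θ * n ^ (k - 1)) = (1 / (2 * k) * n) ^ (k - 1) := by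
            rw [mul_pow, hθ]; field_simp; norm_num
        _ = (x / 2) ^ (k - 1) := by congr 1; rw [hx]; field_simp
        _ ≤ _ := by gcongr; exact hsz i)
  exact ⟨M, hME, hM, by omega⟩

lemma extremal (hk : 3 ≤ k) : ∃ η : ℝ, 0 < η ∧ ∃ n0 : ℕ, ∀ (α : Type) [Fintype α],
    n0 ≤ Fintype.card α → ∀ E : Finset (Fin k → α), Deg E → ∀ A : Fin k → Finset α,
    (∀ i, |((A i).card : ℝ) - Fintype.card α / k| ≤ η * Fintype.card α) →
    cnt (fun f => f ∈ E ∧ ∀ j, f j ∉ A j) ≤ η * (Fintype.card α : ℝ) ^ k →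
    ∃ M ⊆ E, Mat M ∧ Fintype.card α ≤ M.card + 1 := by
  have hk3 : (3 : ℝ) ≤ k := by exact_mod_cast hk
  have hk0 : (0 : ℝ) < k := by linarith
  set θ : ℝ := (1 / (2 * k)) ^ (k - 1) / (8 * k) with hθ
  have hθ0 : 0 < θ := by positivity
  have hθ1 : θ ≤ (1 / 2) ^ k := by
    have h1 : (1 / (2 * k : ℝ)) ^ (k - 1) ≤ (1 / 2) ^ (k - 1) := by
      apply pow_le_pow_left₀ (by positivity)
      apply one_div_le_one_div_of_le (by norm_num)
      linarith
    have h4 : (1 / 2 : ℝ) ^ k = (1 / 2) ^ (k - 1) * (1 / 2) := by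
      rw [← pow_succ]; congr 1; omega
    rw [hθ, div_le_iff₀ (by positivity), h4]
    have : 0 < (1 / 2 : ℝ) ^ (k - 1) := by positivity
    nlinarith
  refine ⟨θ ^ 3 / (1000 * k ^ 4), by positivity, 8 * k ^ 3, ?_⟩
  intro α _ hn E hE A hA hB
  have hn0 : 0 < Fintype.card α := lt_of_lt_of_le (by positivity) hn
  obtain ⟨A', hS⟩ := clean2 hk hn0 hE A hθ0 hθ1 rfl hA hB
  exact ext_core hk hE A' hθ hn hS

lemma main (hk : 3 ≤ k) : ∃ n0 : ℕ, ∀ (α : Type) [Fintype α],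
    n0 ≤ Fintype.card α → ∀ E : Finset (Fin k → α), Deg E →
    ∃ M ⊆ E, Mat M ∧ Fintype.card α ≤ M.card + 1 := by
  have hk3 : (3 : ℝ) ≤ k := by exact_mod_cast hk
  have hk0 : (0 : ℝ) < k := by linarith
  obtain ⟨η, hη, n1, h1⟩ := extremal hk
  set c : ℝ := k * (k * (1 + k * (k + 1))) with hc
  have hc0 : 0 < c := by positivity
  obtain ⟨D0, hD0⟩ := exists_nat_gt (c / η)
  set D := D0 + 2 * k ^ 4 + 1 with hD
  obtain ⟨n2, h2⟩ := absorbing hk D (k * k) (by omega)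
  have hDpos : (0 : ℝ) < D := by rw [hD]; positivity
  have hDη : c * (1 / D) ≤ η := by
    have h3 : c / η < D := by
      refine hD0.trans_le ?_
      have : D0 ≤ D := by omega
      exact_mod_cast this
    rw [div_lt_iff₀ hη] at h3
    rw [mul_one_div, div_le_iff₀ hDpos]
    linarith
  refine ⟨n1 + n2, ?_⟩
  intro α _ hn E hE
  obtain ⟨i0, i1, h01, M0, hM0E, hM0, hM0c, hM0a⟩ := h2 α (by omega) E hE
  have hM0c' : (M0.card : ℝ) ≤ 1 / D * Fintype.card α := by
    rw [div_mul_eq_mul_div, one_mul, le_div_iff₀ hDpos]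
    have : (D : ℝ) * M0.card ≤ Fintype.card α := by exact_mod_cast hM0c
    linarith
  rcases near_or_ext (by omega) hE hM0 hM0E (by positivity) hM0c' with h | h
  · obtain ⟨M, hME, hM, hM0M, hc⟩ := h
    exact absorb_all (by omega) h01 (k * k) M hME hM M0 hM0M hM0a (by omega)
  · obtain ⟨A, hA, hB⟩ := h
    have hnn : (0 : ℝ) ≤ Fintype.card α := by positivity
    refine h1 α (by omega) E hE A (fun i => (hA i).trans ?_) (hB.trans ?_)
    · gcongr
      refine le_trans ?_ hDη
      gcongr
      have : (0 : ℝ) < k * (1 + k * (k + 1)) := by positivity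
      rw [hc]; nlinarith
    · have hpow : (Fintype.card α : ℝ) ^ k = Fintype.card α * (Fintype.card α : ℝ) ^ (k - 1) := by
        rw [← pow_succ']; congr 1; omega
      calc _ = (c * (1 / D)) * (Fintype.card α : ℝ) ^ k := by rw [hpow, hc]; ring
        _ ≤ _ := by gcongr

end KPM

/-- main theorem: For k ≥ 3 and n sufficiently large, every k-partite
k-graph with n vertices in each class and minimum legal co-degree at least n/k has a
matching of size at least n - 1. -/
theorem stmt12 (k : ℕ) (hk : 3 ≤ k) :
    ∃ n0 : ℕ, ∀ n : ℕ, n0 ≤ n →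
    ∀ (α : Type) [Fintype α] [DecidableEq α],
    ∀ P : Fin k → Finset α,
    (∀ v : α, ∃! i, v ∈ P i) →
    (∀ i, (P i).card = n) →
    ∀ E : Finset (Finset α),
    (∀ e ∈ E, ∀ i, (e ∩ P i).card = 1) →
    (∀ S : Finset α, S.card = k - 1 → (∀ i, (S ∩ P i).card ≤ 1) →
      (n : ℝ) / k ≤ ((Finset.univ.filter (fun v => insert v S ∈ E)).card : ℝ)) →
    ∃ M ⊆ E, (∀ a ∈ M, ∀ b ∈ M, a ≠ b → Disjoint a b) ∧ n - 1 ≤ M.card := by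
  obtain ⟨n0, hmain⟩ := KPM.main hk
  refine ⟨n0, ?_⟩
  intro n hn α _ _ P hpart hcard E hE hdeg
  have hg : ∀ i : Fin k, ∃ g : Fin n → α, Function.Injective g ∧ (∀ x, g x ∈ P i) ∧
      ∀ v ∈ P i, ∃ x, g x = v := by
    intro i
    let σ := (Finset.equivFinOfCardEq (hcard i)).symm
    refine ⟨fun x => (σ x).1, fun x y h => σ.injective (Subtype.ext h), fun x => (σ x).2, ?_⟩
    intro v hv
    exact ⟨σ.symm ⟨v, hv⟩, by simp⟩
  choose g hg1 hg2 hg3 using hg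
  have huniq : ∀ v i j, v ∈ P i → v ∈ P j → i = j := fun v i j h1 h2 =>
    (hpart v).unique h1 h2
  have hgg : ∀ i j x y, g i x = g j y → i = j := fun i j x y h =>
    huniq _ i j (hg2 i x) (h ▸ hg2 j y)
  let V : (Fin k → Fin n) → Finset α := fun f => Finset.univ.image (fun i => g i (f i))
  have hV : ∀ f v, v ∈ V f ↔ ∃ i, g i (f i) = v := by intro f v; simp [V]
  let E' : Finset (Fin k → Fin n) := Finset.univ.filter (fun f => V f ∈ E)
  have hE' : ∀ f, f ∈ E' ↔ V f ∈ E := by intro f; simp [E']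
  have hD : KPM.Deg E' := by
    intro f i
    let S : Finset α := (Finset.univ.erase i).image (fun j => g j (f j))
    have hS : ∀ v, v ∈ S ↔ ∃ j, j ≠ i ∧ g j (f j) = v := by intro v; simp [S]
    have hSc : S.card = k - 1 := by
      rw [Finset.card_image_of_injective _ (fun a b h => hgg a b _ _ h)]
      simp
    have h1 := hdeg S hSc (by
      intro j
      rw [Finset.card_le_one]
      intro a ha b hb
      rw [Finset.mem_inter, hS] at ha hb
      obtain ⟨⟨ja, _, rfl⟩, ha2⟩ := ha
      obtain ⟨⟨jb, _, rfl⟩, hb2⟩ := hb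
      have h1 := huniq _ _ _ (hg2 ja (f ja)) ha2
      have h2 := huniq _ _ _ (hg2 jb (f jb)) hb2
      rw [h1, h2])
    rw [Fintype.card_fin]
    refine h1.trans ?_
    rw [KPM.cnt_eq]
    have h2 : (Finset.univ.filter (fun v => insert v S ∈ E)) ⊆
        (Finset.univ.filter (fun x => Function.update f i x ∈ E')).image (g i) := by
      intro v hv
      simp only [Finset.mem_filter, Finset.mem_univ, true_and] at hv
      have h3 := hE _ hv i
      obtain ⟨w, hw⟩ := Finset.card_pos.mp (by rw [h3]; exact one_pos)
      rw [Finset.mem_inter, Finset.mem_insert] at hw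
      have hvP : v ∈ P i := by
        rcases hw.1 with h | h
        · rw [← h]; exact hw.2
        · obtain ⟨j, hj, rfl⟩ := (hS w).mp h
          exact absurd (huniq _ _ _ (hg2 j _) hw.2) hj
      obtain ⟨x, rfl⟩ := hg3 i v hvP
      refine Finset.mem_image.mpr ⟨x, ?_, rfl⟩
      simp only [Finset.mem_filter, Finset.mem_univ, true_and]
      rw [hE']
      have h4 : V (Function.update f i x) = insert (g i x) S := by
        ext u
        rw [hV, Finset.mem_insert, hS]
        constructor
        · rintro ⟨j, rfl⟩
          by_cases hj : j = i
          · subst hj; left; rw [Function.update_self]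
          · right; exact ⟨j, hj, by rw [Function.update_of_ne hj]⟩
        · rintro (rfl | ⟨j, hj, rfl⟩)
          · exact ⟨i, by rw [Function.update_self]⟩
          · exact ⟨j, by rw [Function.update_of_ne hj]⟩
      rw [h4]; exact hv
    exact_mod_cast (Finset.card_le_card h2).trans Finset.card_image_le
  obtain ⟨M, hME, hM, hMc⟩ := hmain (Fin n) (by rw [Fintype.card_fin]; exact hn) E' hD
  rw [Fintype.card_fin] at hMc
  have hmeet : ∀ a ∈ M, ∀ b ∈ M, ∀ w, w ∈ V a → w ∈ V b → a = b := by
    intro a ha b hb w h1 h2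
    obtain ⟨i, rfl⟩ := (hV a w).mp h1
    obtain ⟨j, h3⟩ := (hV b _).mp h2
    have hij := hgg _ _ _ _ h3
    subst hij
    exact hM a ha b hb j (hg1 j h3).symm
  have hinj : Set.InjOn V M := by
    intro a ha b hb h
    let z : Fin k := ⟨0, by omega⟩
    have h1 : g z (a z) ∈ V a := (hV a _).mpr ⟨z, rfl⟩
    exact hmeet a ha b hb _ h1 (h ▸ h1)
  refine ⟨M.image V, ?_, ?_, ?_⟩
  · intro e he
    obtain ⟨a, ha, rfl⟩ := Finset.mem_image.mp he
    exact (hE' a).mp (hME ha)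
  · intro a ha b hb hab
    obtain ⟨a, hxa, rfl⟩ := Finset.mem_image.mp ha
    obtain ⟨b, hxb, rfl⟩ := Finset.mem_image.mp hb
    rw [Finset.disjoint_left]
    intro w h1 h2
    exact hab (by rw [hmeet a hxa b hxb w h1 h2])
  · rw [Finset.card_image_of_injOn hinj]
    omega
end

section
/- Let k ≥ 2, l ∈ [k-1], α > 0, and n sufficiently large. Let H be a k-partite k-graph with classes V_1,...,V_k of size n. If for every legal l-set S ⊆ V_1 ∪ ... ∪ V_l and every legal (k-l)-set S' ⊆ V_{l+1} ∪ ... ∪ V_k one has d_H(S)/n^{k-l} + d_H(S')/n^l > 1 + α, then H contains a perfect matching. -/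
open Finset in
lemma pk_avg_exp (n : ℕ) (X : Fin (n+1) → ℝ) (m t : ℝ) (ht0 : 0 ≤ t) (ht : t ≤ 1/2)
    (hm : ∑ p, X p = (n+1) * m) (hB : ∀ p, |X p - m| ≤ 2) :
    ∑ p, Real.exp (-t * X p) ≤ (n+1) * Real.exp (-t * m + 4 * t^2) := by
  have h1 : ∀ p, Real.exp (-t * X p) ≤
      Real.exp (-t * m) * (1 + (-t * (X p - m)) + 4 * t^2) := by
    intro p
    have e : Real.exp (-t * X p) = Real.exp (-t * m) * Real.exp (-t * (X p - m)) := by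
      rw [← Real.exp_add]; congr 1; ring
    rw [e]
    apply mul_le_mul_of_nonneg_left _ (Real.exp_pos _).le
    have hb := hB p
    have hy : |-t * (X p - m)| ≤ 1 := by
      rw [abs_mul, abs_neg, abs_of_nonneg ht0]
      nlinarith [abs_nonneg (X p - m)]
    have h2 := Real.abs_exp_sub_one_sub_id_le hy
    have h3 := (abs_le.mp h2).2
    have h4 : (X p - m)^2 ≤ 4 := by
      rw [← sq_abs]; nlinarith [abs_nonneg (X p - m)]
    nlinarith [sq_nonneg t, mul_le_mul_of_nonneg_left h4 (sq_nonneg t)]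
  calc _ ≤ ∑ p, Real.exp (-t * m) * (1 + (-t * (X p - m)) + 4 * t^2) :=
        Finset.sum_le_sum fun p _ => h1 p
    _ = (n+1) * (Real.exp (-t * m) * (1 + 4 * t^2)) := by
        rw [← Finset.mul_sum, Finset.sum_add_distrib, Finset.sum_add_distrib, ← Finset.mul_sum,
          Finset.sum_sub_distrib, hm]
        simp
        ring
    _ ≤ _ := by
        rw [Real.exp_add]
        have := Real.add_one_le_exp (4 * t^2)
        have h0 := Real.exp_pos (-t * m)
        gcongr
        linarith

lemma pk_swap_sum (n : ℕ) (f : Fin (n+1) → ℝ) (p : Fin (n+1)) :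
    ∑ j : Fin n, f (Equiv.swap 0 p j.succ) = ∑ q, f q - f p := by
  have h := Equiv.sum_comp (Equiv.swap 0 p) f
  rw [Fin.sum_univ_succ] at h
  simp only [Equiv.swap_apply_left] at h
  linarith

lemma pk_perm {I : Type*} [Fintype I] (t : ℝ) (ht0 : 0 ≤ t) (ht : t ≤ 1/2) (n : ℕ) :
    ∀ (F : I → Fin n → Fin n → ℝ) (w : I → ℝ), (∀ i, 0 ≤ w i) →
    (∀ i a b, 0 ≤ F i a b) → (∀ i a b, F i a b ≤ 1) →
    ∃ σ : Equiv.Perm (Fin n), ∑ i, w i * Real.exp (-t * ∑ j, F i j (σ j)) ≤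
      ∑ i, w i * Real.exp (-t * ((∑ a, ∑ b, F i a b) / n) + 4 * t^2 * n) := by
  induction n with
  | zero => intro F w _ _ _; exact ⟨1, by simp⟩
  | succ n ih =>
    intro F w hw h0 h1
    let mn : Fin (n+1) → I → Fin n → Fin n → ℝ :=
      fun p i a b => F i a.succ (Equiv.swap 0 p b.succ)
    let X : I → Fin (n+1) → ℝ := fun i p => F i 0 p + (∑ a, ∑ b, mn p i a b) / n
    have key : ∀ i, ∑ p, Real.exp (-t * X i p) ≤
        (n+1) * Real.exp (-t * ((∑ a, ∑ b, F i a b) / (n+1)) + 4 * t^2) := by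
      intro i
      let T : ℝ := ∑ a : Fin n, ∑ q, F i a.succ q
      let c : Fin (n+1) → ℝ := fun p => ∑ a : Fin n, F i a.succ p
      have hX : ∀ p, X i p = F i 0 p + (T - c p) / n := by
        intro p
        simp only [X, mn, T, c]
        congr 2
        rw [← Finset.sum_sub_distrib]
        exact Finset.sum_congr rfl fun a _ => pk_swap_sum n (fun q => F i a.succ q) p
      have hc0 : ∀ p, 0 ≤ c p := fun p => Finset.sum_nonneg fun a _ => h0 _ _ _
      have hc1 : ∀ p, c p ≤ n := by
        intro p
        calc c p ≤ ∑ a : Fin n, (1:ℝ) := Finset.sum_le_sum fun a _ => h1 _ _ _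
          _ = n := by simp
      have hcT : ∑ p, c p = T := Finset.sum_comm
      have hS : ∑ a, ∑ b, F i a b = ∑ p, F i 0 p + T := by
        rw [Fin.sum_univ_succ]
      have hsum : ∑ p, X i p = ∑ a, ∑ b, F i a b := by
        rw [hS]
        simp only [hX]
        rw [Finset.sum_add_distrib, ← Finset.sum_div, Finset.sum_sub_distrib, hcT]
        congr 1
        rcases Nat.eq_zero_or_pos n with h | h
        · subst h; simp [T]
        · have : (n:ℝ) ≠ 0 := by positivity
          simp; field_simp; ring
      have hn1 : (0:ℝ) < n + 1 := by positivity
      have hcd : ∀ p, 0 ≤ c p / n ∧ c p / n ≤ 1 := fun p =>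
        ⟨div_nonneg (hc0 p) (by positivity), div_le_one_of_le₀ (hc1 p) (by positivity)⟩
      have hlo : ∀ p, T / n - 1 ≤ X i p := by
        intro p; rw [hX, sub_div]; linarith [h0 i 0 p, (hcd p).2]
      have hhi : ∀ p, X i p ≤ T / n + 1 := by
        intro p; rw [hX, sub_div]; linarith [h1 i 0 p, (hcd p).1]
      have hm1 : T / n - 1 ≤ (∑ a, ∑ b, F i a b) / (n+1) := by
        rw [le_div_iff₀ hn1, ← hsum]
        calc _ = ∑ p : Fin (n+1), (T / n - 1) := by simp; ring
          _ ≤ _ := Finset.sum_le_sum fun p _ => hlo p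
      have hm2 : (∑ a, ∑ b, F i a b) / (n+1) ≤ T / n + 1 := by
        rw [div_le_iff₀ hn1, ← hsum]
        calc _ ≤ ∑ p : Fin (n+1), (T / n + 1) := Finset.sum_le_sum fun p _ => hhi p
          _ = _ := by simp; ring
      apply pk_avg_exp n (X i) _ t ht0 ht
      · rw [hsum]; field_simp
      · intro p
        rw [abs_le]; constructor <;> linarith [hlo p, hhi p]
    -- pick a good first value
    have hp : ∃ p : Fin (n+1), ∑ i, w i * Real.exp (-t * X i p) ≤
        ∑ i, w i * Real.exp (-t * ((∑ a, ∑ b, F i a b) / (n+1)) + 4 * t^2) := by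
      by_contra hcon
      push Not at hcon
      have h2 := Finset.sum_lt_sum_of_nonempty (s := (Finset.univ : Finset (Fin (n+1))))
        Finset.univ_nonempty (fun p _ => hcon p)
      rw [Finset.sum_comm (s := Finset.univ (α := Fin (n+1)))
        (f := fun p i => w i * Real.exp (-t * X i p))] at h2
      have h3 : ∑ i, ∑ p, w i * Real.exp (-t * X i p) ≤
          ∑ i, w i * ((n+1) * Real.exp (-t * ((∑ a, ∑ b, F i a b) / (n+1)) + 4 * t^2)) := by
        apply Finset.sum_le_sum
        intro i _
        rw [← Finset.mul_sum]
        exact mul_le_mul_of_nonneg_left (key i) (hw i)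
      have h4 : ∑ _p : Fin (n+1), ∑ i, w i * Real.exp (-t * ((∑ a, ∑ b, F i a b) / (n+1)) + 4 * t^2)
          = ∑ i, w i * ((n+1) * Real.exp (-t * ((∑ a, ∑ b, F i a b) / (n+1)) + 4 * t^2)) := by
        rw [Finset.sum_const, Finset.card_univ, Fintype.card_fin, nsmul_eq_mul, Finset.mul_sum]
        apply Finset.sum_congr rfl
        intro i _
        push_cast; ring
      linarith
    obtain ⟨p, hp⟩ := hp
    obtain ⟨τ, hτ⟩ := ih (mn p) (fun i => w i * Real.exp (-t * F i 0 p))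
      (fun i => mul_nonneg (hw i) (Real.exp_pos _).le) (fun i a b => h0 _ _ _) (fun i a b => h1 _ _ _)
    refine ⟨Equiv.Perm.decomposeFin.symm (p, τ), ?_⟩
    have hE : (0:ℝ) ≤ Real.exp (4 * t^2 * n) := (Real.exp_pos _).le
    have hp2 := mul_le_mul_of_nonneg_right hp hE
    rw [Finset.sum_mul, Finset.sum_mul] at hp2
    calc _ = ∑ i, (w i * Real.exp (-t * F i 0 p)) * Real.exp (-t * ∑ j, mn p i j (τ j)) := by
          apply Finset.sum_congr rfl
          intro i _
          rw [Fin.sum_univ_succ, mul_assoc, ← Real.exp_add]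
          simp only [Equiv.Perm.decomposeFin_symm_apply_zero,
            Equiv.Perm.decomposeFin_symm_apply_succ, mn]
          congr 2; ring
      _ ≤ _ := hτ
      _ = ∑ i, w i * Real.exp (-t * X i p) * Real.exp (4 * t^2 * n) := by
          apply Finset.sum_congr rfl
          intro i _
          rw [mul_assoc (w i), mul_assoc (w i), ← Real.exp_add, ← Real.exp_add]
          simp only [X]
          congr 2; ring
      _ ≤ _ := hp2
      _ = _ := by
          apply Finset.sum_congr rfl
          intro i _
          rw [mul_assoc, ← Real.exp_add]
          congr 2; push_cast; ring

lemma pk_matrix (C : ℕ) (ε : ℝ) (hε : 0 < ε) (hε1 : ε ≤ 1) : ∃ n0 : ℕ, ∀ n : ℕ, n0 ≤ n →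
    ∀ (I : Type) [Fintype I], Fintype.card I ≤ n ^ C →
    ∀ F : I → Fin n → Fin n → ℝ, (∀ i a b, 0 ≤ F i a b) → (∀ i a b, F i a b ≤ 1) →
    ∃ σ : Equiv.Perm (Fin n), ∀ i, (∑ a, ∑ b, F i a b) / n - ε * n ≤ ∑ j, F i j (σ j) := by
  have hlim := (tendsto_exp_mul_div_rpow_atTop (C:ℝ) (ε^2/16) (by positivity)).comp
    tendsto_natCast_atTop_atTop
  have hev := (hlim.eventually_gt_atTop 1).and (Filter.eventually_gt_atTop 0)
  obtain ⟨n0, hn0⟩ := Filter.eventually_atTop.mp hev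
  refine ⟨n0, fun n hn I _ hI F h0 h1 => ?_⟩
  obtain ⟨hgt, hpos⟩ := hn0 n hn
  have hpos' : (0:ℝ) < n := by exact_mod_cast hpos
  simp only [Function.comp, Real.rpow_natCast] at hgt
  rw [lt_div_iff₀ (by positivity), one_mul] at hgt
  let μ : I → ℝ := fun i => (∑ a, ∑ b, F i a b) / n
  set t : ℝ := ε / 8 with ht
  obtain ⟨σ, hσ⟩ := pk_perm t (by positivity) (by linarith) n F (fun i => Real.exp (t * μ i))
    (fun i => (Real.exp_pos _).le) h0 h1
  refine ⟨σ, fun i => ?_⟩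
  by_contra hcon
  push Not at hcon
  have e1 : ∑ i, Real.exp (t * μ i) * Real.exp (-t * ((∑ a, ∑ b, F i a b) / n) + 4 * t^2 * n)
      = Fintype.card I * Real.exp (4 * t^2 * n) := by
    rw [Finset.sum_congr rfl (g := fun _ => Real.exp (4 * t^2 * n))]
    · simp
    · intro i _
      rw [← Real.exp_add]; congr 1; simp only [μ]; ring
  rw [e1] at hσ
  have e2 := Finset.single_le_sum
    (f := fun i => Real.exp (t * μ i) * Real.exp (-t * ∑ j, F i j (σ j)))
    (fun i _ => by positivity) (Finset.mem_univ i)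
  have e3 : Real.exp (t * (ε * n)) ≤ Real.exp (t * μ i) * Real.exp (-t * ∑ j, F i j (σ j)) := by
    rw [← Real.exp_add]
    apply Real.exp_le_exp.mpr
    have : ε * n ≤ μ i - ∑ j, F i j (σ j) := by simp only [μ]; linarith
    have := mul_le_mul_of_nonneg_left this (show 0 ≤ t by positivity)
    linarith
  have e4 : (Fintype.card I : ℝ) ≤ (n:ℝ)^C := by exact_mod_cast hI
  have e5 : Real.exp (t * (ε * n)) = Real.exp (ε^2/16*n) * Real.exp (4 * t^2 * n) := by
    rw [← Real.exp_add]; congr 1; rw [ht]; ring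
  have e6 := Real.exp_pos (4 * t^2 * n)
  have e7 : (Fintype.card I : ℝ) * Real.exp (4 * t^2 * n)
      < Real.exp (ε^2/16*n) * Real.exp (4 * t^2 * n) :=
    mul_lt_mul_of_pos_right (lt_of_le_of_lt e4 hgt) e6
  linarith

lemma pk_multi (m : ℕ) (ε : ℝ) (hε : 0 < ε) (hε1 : ε ≤ 1) : ∀ C : ℕ, ∃ n0 : ℕ, ∀ n : ℕ, n0 ≤ n →
    ∀ (I : Type) [Fintype I], Fintype.card I ≤ n ^ C →
    ∀ G : I → (Fin m → Fin n) → ℝ, (∀ i f, 0 ≤ G i f) → (∀ i f, G i f ≤ 1) →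
    ∃ σ : Fin m → Equiv.Perm (Fin n), ∀ i,
      (∑ f, G i f) / n ^ m - m * ε ≤ (∑ j, G i (fun r => σ r j)) / n := by
  induction m with
  | zero =>
    intro C
    refine ⟨1, fun n hn I _ _ G _ _ => ⟨fun _ => 1, fun i => ?_⟩⟩
    have : (n:ℝ) ≠ 0 := by positivity
    have e : ∀ j : Fin n, G i (fun r : Fin 0 => (1 : Equiv.Perm (Fin n)) j) = G i default :=
      fun j => congrArg _ (Subsingleton.elim _ _)
    simp only [e]
    simp
    field_simp
    exact le_of_eq (congrArg _ (Subsingleton.elim _ _))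
  | succ m ih =>
    intro C
    obtain ⟨n1, hn1⟩ := ih (C+1)
    obtain ⟨n2, hn2⟩ := pk_matrix C ε hε hε1
    refine ⟨max (max n1 n2) 1, fun n hn I _ hI G h0 h1 => ?_⟩
    have a1 : n1 ≤ n := by omega
    have a2 : n2 ≤ n := by omega
    have a3 : (0:ℝ) < n := by
      have : 0 < n := by omega
      exact_mod_cast this
    obtain ⟨σ, hσ⟩ := hn1 n a1 (I × Fin n) (by
      rw [Fintype.card_prod, Fintype.card_fin, pow_succ]; exact Nat.mul_le_mul_right _ hI)
      (fun x u => G x.1 (Fin.cons x.2 u)) (fun _ _ => h0 _ _) (fun _ _ => h1 _ _)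
    obtain ⟨τ, hτ⟩ := hn2 n a2 I hI (fun i j b => G i (Fin.cons b (fun r => σ r j)))
      (fun _ _ _ => h0 _ _) (fun _ _ _ => h1 _ _)
    refine ⟨Fin.cons τ σ, fun i => ?_⟩
    have e1 : ∀ j, (fun r => (Fin.cons τ σ : Fin (m+1) → Equiv.Perm (Fin n)) r j)
        = Fin.cons (τ j) (fun r => σ r j) := by
      intro j; funext r; refine Fin.cases ?_ (fun s => ?_) r <;> simp
    simp only [e1]
    have e2 : ∑ f, G i f = ∑ b : Fin n, ∑ u : Fin m → Fin n, G i (Fin.cons b u) := by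
      rw [← Fintype.sum_prod_type']
      exact (Equiv.sum_comp (Fin.consEquiv (fun _ : Fin (m+1) => Fin n)) (G i)).symm
    have h3 := hτ i
    have h4 : ∑ b : Fin n, ((∑ u, G i (Fin.cons b u)) / n ^ m - m * ε) ≤
        ∑ b : Fin n, (∑ j, G i (Fin.cons b (fun r => σ r j))) / n :=
      Finset.sum_le_sum fun b _ => hσ (i, b)
    rw [Finset.sum_sub_distrib, ← Finset.sum_div, ← Finset.sum_div, ← e2, Finset.sum_comm] at h4
    simp only [Finset.sum_const, Finset.card_univ, Fintype.card_fin, nsmul_eq_mul] at h4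
    have h5 := h4.trans (sub_le_iff_le_add.mp h3)
    rw [le_div_iff₀ a3]
    have h6 : (∑ f, G i f) / (n:ℝ)^(m+1) * n = (∑ f, G i f) / (n:ℝ)^m := by
      field_simp
      ring
    rw [sub_mul, h6]
    push_cast
    linarith

open Classical in
lemma pk_hall (n : ℕ) (B : Fin n → Fin n → Prop)
    (h : ∀ i j, n ≤ (Finset.univ.filter (fun j' => B i j')).card
      + (Finset.univ.filter (fun i' => B i' j)).card) :
    ∃ π : Equiv.Perm (Fin n), ∀ i, B i (π i) := by
  have := (Finset.all_card_le_biUnion_card_iff_exists_injective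
    (fun i : Fin n => Finset.univ.filter (fun j' => B i j'))).mp (by
    intro s
    by_contra hcon
    push Not at hcon
    set N := s.biUnion (fun i : Fin n => Finset.univ.filter (fun j' => B i j')) with hN
    have hs : s.Nonempty := Finset.card_pos.mp (by omega)
    obtain ⟨i, hi⟩ := hs
    have hsn : s.card ≤ n := by simpa using Finset.card_le_univ s
    have : ∃ j, j ∉ N := by
      by_contra hall
      push Not at hall
      have : N = Finset.univ := Finset.eq_univ_iff_forall.mpr hall
      rw [this] at hcon
      simp at hcon
      omega
    obtain ⟨j, hj⟩ := this
    have c1 : (Finset.univ.filter (fun j' => B i j')).card ≤ N.card :=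
      Finset.card_le_card (Finset.subset_biUnion_of_mem
        (fun i : Fin n => Finset.univ.filter (fun j' => B i j')) hi)
    have c2 : (Finset.univ.filter (fun i' => B i' j)).card ≤ sᶜ.card := by
      apply Finset.card_le_card
      intro i' hi'
      rw [Finset.mem_compl]
      intro hmem
      exact hj (Finset.mem_biUnion.mpr ⟨i', hmem, by simpa using hi'⟩)
    rw [Finset.card_compl, Fintype.card_fin] at c2
    have := h i j
    omega)
  obtain ⟨f, hf, hB⟩ := this
  refine ⟨Equiv.ofBijective f (Finite.injective_iff_bijective.mp hf), fun i => ?_⟩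
  simpa using hB i

open Classical in
lemma pk_abstract (l r : ℕ) (a : ℝ) (ha : 0 < a) : ∃ n0 : ℕ, ∀ n : ℕ, n0 ≤ n →
    ∀ W : (Fin l → Fin n) → (Fin r → Fin n) → Prop,
    (∀ f g, 1 + a < ((Finset.univ.filter (fun g' => W f g')).card : ℝ) / n ^ r
      + ((Finset.univ.filter (fun f' => W f' g)).card : ℝ) / n ^ l) →
    ∃ (σ : Fin l → Equiv.Perm (Fin n)) (τ : Fin r → Equiv.Perm (Fin n)),
      ∀ j, W (fun i => σ i j) (fun i => τ i j) := by
  set ε : ℝ := min 1 (a / (l + r + 1)) with hεd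
  have hε : 0 < ε := lt_min one_pos (by positivity)
  have hεa : l * ε + r * ε ≤ a := by
    have : ε ≤ a / (l + r + 1) := min_le_right _ _
    rw [le_div_iff₀ (by positivity)] at this
    linarith
  obtain ⟨n1, h1⟩ := pk_multi l ε hε (min_le_left _ _) r
  obtain ⟨n2, h2⟩ := pk_multi r ε hε (min_le_left _ _) l
  refine ⟨max (max n1 n2) 1, fun n hn W hW => ?_⟩
  have a3 : (0:ℝ) < n := by
    have : 0 < n := by omega
    exact_mod_cast this
  obtain ⟨σ, hσ⟩ := h1 n (by omega) (Fin r → Fin n) (by simp)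
    (fun g f => if W f g then 1 else 0) (fun _ _ => by split_ifs <;> norm_num)
    (fun _ _ => by split_ifs <;> norm_num)
  obtain ⟨τ, hτ⟩ := h2 n (by omega) (Fin l → Fin n) (by simp)
    (fun f g => if W f g then 1 else 0) (fun _ _ => by split_ifs <;> norm_num)
    (fun _ _ => by split_ifs <;> norm_num)
  simp only [Finset.sum_boole] at hσ hτ
  obtain ⟨π, hπ⟩ := pk_hall n (fun i j => W (fun s => σ s i) (fun s => τ s j)) (by
    intro i j
    have q1 := hσ (fun s => τ s j)
    have q2 := hτ (fun s => σ s i)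
    have q3 := hW (fun s => σ s i) (fun s => τ s j)
    have q4 : (1:ℝ) < ((Finset.univ.filter (fun j' => W (fun s => σ s i) (fun s => τ s j'))).card : ℝ) / n
      + ((Finset.univ.filter (fun i' => W (fun s => σ s i') (fun s => τ s j))).card : ℝ) / n := by
      linarith
    rw [← add_div, lt_div_iff₀ a3, one_mul] at q4
    exact_mod_cast q4.le)
  exact ⟨σ, fun s => π.trans (τ s), hπ⟩

/-- Pikhurko's theorem: k ≥ 2, l ∈ [k-1], α > 0, n large. If for every
legal l-set S ⊆ V_1 ∪ ... ∪ V_l and every legal (k-l)-set S' ⊆ V_{l+1} ∪ ... ∪ V_k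
we have d_H(S)/n^{k-l} + d_H(S')/n^l > 1 + α, then H has a perfect matching. -/
theorem stmt15 (k l : ℕ) (hk : 2 ≤ k) (hl1 : 1 ≤ l) (hl2 : l ≤ k - 1)
    (a : ℝ) (ha : 0 < a) :
    ∃ n0 : ℕ, ∀ n : ℕ, n0 ≤ n →
    ∀ (α : Type) [Fintype α] [DecidableEq α],
    ∀ P : Fin k → Finset α,
    (∀ v : α, ∃! i, v ∈ P i) →
    (∀ i, (P i).card = n) →
    ∀ E : Finset (Finset α),
    (∀ e ∈ E, ∀ i, (e ∩ P i).card = 1) →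
    (∀ S S' : Finset α, S.card = l → S'.card = k - l →
      (∀ i, (S ∩ P i).card ≤ 1) → (∀ i, (S' ∩ P i).card ≤ 1) →
      (∀ v ∈ S, ∃ i : Fin k, (i : ℕ) < l ∧ v ∈ P i) →
      (∀ v ∈ S', ∃ i : Fin k, l ≤ (i : ℕ) ∧ v ∈ P i) →
      1 + a < ((E.filter (fun e => S ⊆ e)).card : ℝ) / (n : ℝ)^(k - l)
        + ((E.filter (fun e => S' ⊆ e)).card : ℝ) / (n : ℝ)^l) →
    ∃ M ⊆ E, (∀ e ∈ M, ∀ f ∈ M, e ≠ f → Disjoint e f) ∧ ∀ v : α, ∃ e ∈ M, v ∈ e := by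
  obtain ⟨r, rfl⟩ : ∃ r, k = l + r := ⟨k - l, by omega⟩
  obtain ⟨n0, hn0⟩ := pk_abstract l r a ha
  refine ⟨n0, fun n hn α _ _ P hP hc E hE hdeg => ?_⟩
  let v : Fin (l + r) → Fin n → α := fun i j => (((P i).equivFinOfCardEq (hc i)).symm j : α)
  have vmem : ∀ i j, v i j ∈ P i := fun i j => Subtype.coe_prop _
  have vsurj : ∀ i, ∀ x ∈ P i, ∃ j, v i j = x := by
    intro i x hx
    refine ⟨(P i).equivFinOfCardEq (hc i) ⟨x, hx⟩, ?_⟩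
    simp [v]
  have vcls : ∀ i i' j, v i j ∈ P i' → i = i' := fun i i' j h =>
    (hP (v i j)).unique (vmem i j) h
  have vinj : ∀ i i' j j', v i j = v i' j' → i = i' ∧ j = j' := by
    intro i i' j j' h
    have : i = i' := vcls i i' j (h ▸ vmem i' j')
    subst this
    refine ⟨rfl, ?_⟩
    exact ((P i).equivFinOfCardEq (hc i)).symm.injective (Subtype.ext h)
  let L : (Fin l → Fin n) → Finset α := fun f =>
    Finset.univ.image (fun s => v (Fin.castAdd r s) (f s))
  let R : (Fin r → Fin n) → Finset α := fun g =>
    Finset.univ.image (fun s => v (Fin.natAdd l s) (g s))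
  have memL : ∀ f x, x ∈ L f ↔ ∃ s, v (Fin.castAdd r s) (f s) = x := by
    intro f x; simp [L]
  have memR : ∀ g x, x ∈ R g ↔ ∃ s, v (Fin.natAdd l s) (g s) = x := by
    intro g x; simp [R]
  -- an edge is determined by its coordinates
  have edge : ∀ e ∈ E, ∃ f g, e = L f ∪ R g := by
    intro e he
    have h1 : ∀ i, ∃ j, e ∩ P i = {v i j} := by
      intro i
      obtain ⟨x, hx⟩ := Finset.card_eq_one.mp (hE e he i)
      have hxm : x ∈ e ∩ P i := by rw [hx]; simp
      obtain ⟨j, hj⟩ := vsurj i x (Finset.mem_inter.mp hxm).2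
      exact ⟨j, by rw [hx, hj]⟩
    choose c hc' using h1
    refine ⟨fun s => c (Fin.castAdd r s), fun s => c (Fin.natAdd l s), ?_⟩
    have hm : ∀ i, v i (c i) ∈ e := fun i => by
      have : v i (c i) ∈ e ∩ P i := by rw [hc' i]; simp
      exact (Finset.mem_inter.mp this).1
    ext x
    rw [Finset.mem_union, memL, memR]
    constructor
    · intro hx
      obtain ⟨i, hi, -⟩ := hP x
      have h2 : x ∈ e ∩ P i := Finset.mem_inter.mpr ⟨hx, hi⟩
      rw [hc' i, Finset.mem_singleton] at h2
      subst h2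
      refine Fin.addCases (fun s => ?_) (fun s => ?_) i
      · exact Or.inl ⟨s, rfl⟩
      · exact Or.inr ⟨s, rfl⟩
    · rintro (⟨s, rfl⟩ | ⟨s, rfl⟩) <;> exact hm _
  have Lsub : ∀ f f' g, L f ⊆ L f' ∪ R g → f = f' := by
    intro f f' g h
    funext s
    have := h ((memL _ _).mpr ⟨s, rfl⟩)
    rw [Finset.mem_union, memL, memR] at this
    rcases this with ⟨s', hs'⟩ | ⟨s', hs'⟩
    · obtain ⟨h1, h2⟩ := vinj _ _ _ _ hs'
      have : s' = s := Fin.castAdd_injective _ _ h1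
      subst this; exact h2.symm
    · have h1 := congrArg Fin.val (vinj _ _ _ _ hs').1
      simp at h1; omega
  have Rsub : ∀ f g g', R g ⊆ L f ∪ R g' → g = g' := by
    intro f g g' h
    funext s
    have := h ((memR _ _).mpr ⟨s, rfl⟩)
    rw [Finset.mem_union, memL, memR] at this
    rcases this with ⟨s', hs'⟩ | ⟨s', hs'⟩
    · have h1 := congrArg Fin.val (vinj _ _ _ _ hs').1
      simp at h1; omega
    · obtain ⟨h1, h2⟩ := vinj _ _ _ _ hs'
      have : s' = s := Fin.natAdd_injective _ _ h1
      subst this; exact h2.symm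
  have Lcard : ∀ f, (L f).card = l := by
    intro f
    rw [Finset.card_image_of_injective _ (fun s s' h => Fin.castAdd_injective _ _ (vinj _ _ _ _ h).1)]
    simp
  have Rcard : ∀ g, (R g).card = r := by
    intro g
    rw [Finset.card_image_of_injective _ (fun s s' h => Fin.natAdd_injective _ _ (vinj _ _ _ _ h).1)]
    simp
  obtain ⟨σ, τ, hW⟩ := hn0 n hn (fun f g => L f ∪ R g ∈ E) (by
    intro f g
    have h := hdeg (L f) (R g) (Lcard f) (by rw [Rcard]; omega)
      (by
        intro i
        rw [Finset.card_le_one]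
        intro x hx y hy
        rw [Finset.mem_inter, memL] at hx hy
        obtain ⟨⟨s, rfl⟩, hx⟩ := hx
        obtain ⟨⟨s', rfl⟩, hy⟩ := hy
        have : s = s' := Fin.castAdd_injective _ _ ((vcls _ _ _ hx).trans (vcls _ _ _ hy).symm)
        rw [this])
      (by
        intro i
        rw [Finset.card_le_one]
        intro x hx y hy
        rw [Finset.mem_inter, memR] at hx hy
        obtain ⟨⟨s, rfl⟩, hx⟩ := hx
        obtain ⟨⟨s', rfl⟩, hy⟩ := hy
        have : s = s' := Fin.natAdd_injective _ _ ((vcls _ _ _ hx).trans (vcls _ _ _ hy).symm)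
        rw [this])
      (by
        intro x hx
        obtain ⟨s, rfl⟩ := (memL _ _).mp hx
        exact ⟨_, by simp, vmem _ _⟩)
      (by
        intro x hx
        obtain ⟨s, rfl⟩ := (memR _ _).mp hx
        exact ⟨_, by simp, vmem _ _⟩)
    rw [Nat.add_sub_cancel_left] at h
    refine lt_of_lt_of_le h (add_le_add ?_ ?_)
    · refine div_le_div_of_nonneg_right (Nat.cast_le.mpr ?_) (by positivity)
      refine Finset.card_le_card_of_surjOn (fun g' => L f ∪ R g') ?_
      intro e he
      rw [Finset.mem_coe, Finset.mem_filter] at he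
      obtain ⟨f', g', rfl⟩ := edge e he.1
      obtain rfl := Lsub _ _ _ he.2
      exact ⟨g', by simpa using he.1, rfl⟩
    · refine div_le_div_of_nonneg_right (Nat.cast_le.mpr ?_) (by positivity)
      refine Finset.card_le_card_of_surjOn (fun f' => L f' ∪ R g) ?_
      intro e he
      rw [Finset.mem_coe, Finset.mem_filter] at he
      obtain ⟨f', g', rfl⟩ := edge e he.1
      obtain rfl := Rsub _ _ _ he.2
      exact ⟨f', by simpa using he.1, rfl⟩)
  -- combined permutations
  let ρ : Fin (l + r) → Equiv.Perm (Fin n) := Fin.addCases σ τ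
  let M : Fin n → Finset α := fun j => L (fun s => σ s j) ∪ R (fun s => τ s j)
  have memM : ∀ j x, x ∈ M j ↔ ∃ i, v i (ρ i j) = x := by
    intro j x
    simp only [M]
    rw [Finset.mem_union, memL, memR]
    constructor
    · rintro (⟨s, rfl⟩ | ⟨s, rfl⟩)
      · exact ⟨Fin.castAdd r s, by simp [ρ]⟩
      · exact ⟨Fin.natAdd l s, by simp [ρ]⟩
    · rintro ⟨i, rfl⟩
      refine Fin.addCases (fun s => ?_) (fun s => ?_) i
      · exact Or.inl ⟨s, by simp [ρ]⟩
      · exact Or.inr ⟨s, by simp [ρ]⟩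
  refine ⟨Finset.univ.image M, ?_, ?_, ?_⟩
  · intro e he
    obtain ⟨j, -, rfl⟩ := Finset.mem_image.mp he
    exact hW j
  · intro e he e' he' hne
    obtain ⟨j, -, rfl⟩ := Finset.mem_image.mp he
    obtain ⟨j', -, rfl⟩ := Finset.mem_image.mp he'
    rw [Finset.disjoint_left]
    intro x hx hx'
    obtain ⟨i, rfl⟩ := (memM _ _).mp hx
    obtain ⟨i', h⟩ := (memM _ _).mp hx'
    obtain ⟨h1, h2⟩ := vinj _ _ _ _ h
    subst h1
    exact hne (by rw [(ρ i').injective h2])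
  · intro x
    obtain ⟨i, hi, -⟩ := hP x
    obtain ⟨j, rfl⟩ := vsurj i x hi
    exact ⟨M ((ρ i).symm j), Finset.mem_image_of_mem _ (Finset.mem_univ _),
      (memM _ _).mpr ⟨i, by simp⟩⟩
end
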